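/- arXiv:1508.02598 — 3 statements merged into one kernel-verified Lean document; each statement's English description precedes it below -/
import Mathlib

section
/- Let T be an unrooted binary phylogenetic X-tree on a set X of n ≥ 2 taxa, and let r ≥ 1. Then the number of convex characters on T with exactly r states in which every state appears on at least 2 taxa is exactly the binomial coefficient C(n−r−1, r−1); in particular this number depends only on n and not on the topology of T. -/
open SimpleGraph

/-- The degree of a vertex in a simple graph, as the cardinality of its neighbour set. -/
noncomputable def vdeg {V : Type} (G : SimpleGraph V) (v : V) : ℕ :=
  (G.neighborSet v).ncard

/-- An unrooted binary phylogenetic tree on taxon set `X` with vertex type `V`: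
a tree in which every vertex has degree 1 or 3, whose degree-1 vertices (leaves)
are bijectively labelled by the taxa in `X`. -/
structure UnrootedBinaryTree (V X : Type) where
  graph : SimpleGraph V
  isTree : graph.IsTree
  degOneOrThree : ∀ v : V, vdeg graph v = 1 ∨ vdeg graph v = 3
  label : X → V
  label_inj : Function.Injective label
  label_leaf : ∀ x : X, vdeg graph (label x) = 1
  leaf_label : ∀ v : V, vdeg graph v = 1 → ∃ x : X, label x = v

/-- A character on `X`: a partition of `X` into nonempty blocks (the states). -/
def IsCharacter {X : Type} (P : Finset (Finset X)) : Prop :=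
  (∀ B ∈ P, B.Nonempty) ∧
  (∀ B ∈ P, ∀ B' ∈ P, B ≠ B' → Disjoint B B') ∧
  (∀ x : X, ∃ B ∈ P, x ∈ B)

/-- A character `P` is convex on `T` if states can be assigned to all vertices of `T`,
agreeing with `P` on the leaves, so that each state induces a connected subgraph. -/
def IsConvexChar {V X : Type} (T : UnrootedBinaryTree V X) (P : Finset (Finset X)) : Prop :=
  ∃ h : V → Finset X,
    (∀ v : V, h v ∈ P) ∧
    (∀ (x : X) (B : Finset X), B ∈ P → x ∈ B → h (T.label x) = B) ∧
    (∀ B ∈ P, (T.graph.induce {v : V | h v = B}).Connected)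

/-- `gCount T k r` : the number of convex characters on `T` with exactly `r` states,
each state appearing on at least `k` taxa. -/
noncomputable def gCount {V X : Type} (T : UnrootedBinaryTree V X) (k r : ℕ) : ℕ :=
  Nat.card {P : Finset (Finset X) //
    IsCharacter P ∧ IsConvexChar T P ∧ P.card = r ∧ ∀ B ∈ P, k ≤ B.card}

/-- `gTotal T k = ∑_{r=1}^{n} gCount T k r`, where `n` is the number of taxa. -/
noncomputable def gTotal {V X : Type} (T : UnrootedBinaryTree V X) (k : ℕ) : ℕ :=
  ∑ r ∈ Finset.Icc 1 (Nat.card X), gCount T k r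

/-- The vertex set of the minimal connecting subtree of a set `A` of taxa:
the union of the vertex sets of all paths between pairs of leaves labelled by `A`. -/
def connSubtree {V X : Type} (T : UnrootedBinaryTree V X) (A : Set X) : Set V :=
  {v : V | ∃ x ∈ A, ∃ y ∈ A,
    ∃ p : T.graph.Walk (T.label x) (T.label y), p.IsPath ∧ v ∈ p.support}

/-- Isomorphism of phylogenetic trees on the same taxon set, fixing each taxon. -/
def PhyloIsomorphic {V₁ V₂ X : Type}
    (T₁ : UnrootedBinaryTree V₁ X) (T₂ : UnrootedBinaryTree V₂ X) : Prop :=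
  ∃ e : T₁.graph ≃g T₂.graph, ∀ x : X, e (T₁.label x) = T₂.label x

/-- Two sets of taxa are separated by some split of the system `Sig`. -/
def Sepd {X : Type} (Sig : Set (Set X)) (B B' : Finset X) : Prop :=
  ∃ C ∈ Sig, (∀ x ∈ B, x ∈ C) ∧ (∀ x ∈ B', x ∉ C)

/-- Partitions of `S` into `r` blocks of size at least two, pairwise separated by `Sig`. -/
def MSet {X : Type} (Sig : Set (Set X)) (S : Finset X) (r : ℕ) : Set (Finset (Finset X)) :=
  {P | P.card = r ∧ (∀ B ∈ P, 2 ≤ B.card) ∧ (∀ x, x ∈ S ↔ ∃ B ∈ P, x ∈ B) ∧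
    ∀ B ∈ P, ∀ B' ∈ P, B ≠ B' → Sepd Sig B B'}

/-- The counting recursion. -/
def FRec : ℕ → ℕ → ℕ
  | 0, 0 => 1
  | 0, _ + 1 => 0
  | 1, _ => 0
  | _ + 2, 0 => 0
  | n + 2, r + 1 => FRec (n + 1) (r + 1) + FRec n r

theorem FRec_eq (n : ℕ) : ∀ r, FRec (n + 2) (r + 1) = Nat.choose (n - r) r := by
  induction n using Nat.strong_induction_on with
  | _ n ih =>
    intro r
    match n, ih with
    | 0, _ => cases r <;> simp [FRec]
    | 1, _ =>
      match r with
      | 0 => simp [FRec]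
      | 1 => simp [FRec]
      | r + 2 => simp [FRec]
    | n + 2, ih =>
      rw [FRec, ih (n + 1) (by omega) r]
      match r with
      | 0 => simp [FRec]
      | r + 1 =>
        rw [ih n (by omega) r]
        by_cases h : r ≤ n
        · obtain ⟨k, rfl⟩ := Nat.exists_eq_add_of_le h
          have e1 : r + k + 1 - (r + 1) = k := by omega
          have e2 : r + k - r = k := by omega
          have e3 : r + k + 2 - (r + 1) = k + 1 := by omega
          rw [e1, e2, e3, Nat.choose_succ_succ, Nat.succ_eq_add_one]; omega
        · have e1 : n + 1 - (r + 1) = 0 := by omega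
          have e2 : n - r = 0 := by omega
          have e3 : n + 2 - (r + 1) = 0 := by omega
          rw [e1, e2, e3]
          obtain ⟨k, rfl⟩ : ∃ k, r = k + 1 := ⟨r - 1, by omega⟩
          simp

section Count
variable {X : Type} (Sig : Set (Set X))

theorem Sepd.not_mem {Sig : Set (Set X)} {B B' : Finset X} (h : Sepd Sig B B') {x : X}
    (hx : x ∈ B) (hx' : x ∈ B') : False := by
  obtain ⟨C, _, h1, h2⟩ := h
  exact h2 x hx' (h1 x hx)

theorem MSet_uniq {Sig : Set (Set X)} {S : Finset X} {r : ℕ} {P : Finset (Finset X)}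
    (hP : P ∈ MSet Sig S r) {B B' : Finset X} (hB : B ∈ P) (hB' : B' ∈ P) {x : X}
    (hx : x ∈ B) (hx' : x ∈ B') : B = B' := by
  by_contra hne
  exact (hP.2.2.2 B hB B' hB' hne).not_mem hx hx'

theorem MSet_step [DecidableEq X] [Finite X]
    (hcompl : ∀ A ∈ Sig, Aᶜ ∈ Sig)
    (hcompat : ∀ A ∈ Sig, ∀ C ∈ Sig, ∀ w x y z : X, w ∈ A → w ∈ C → x ∈ A → x ∉ C →
      y ∉ A → y ∈ C → z ∉ A → z ∉ C → False)
    (S : Finset X) (A : Set X) (hA : A ∈ Sig) (a b : X) (hab : a ≠ b) (haS : a ∈ S) (hbS : b ∈ S)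
    (haA : a ∈ A) (hbA : b ∈ A) (hSA : ∀ x ∈ S, x ∈ A → x = a ∨ x = b) (r : ℕ) :
    (MSet Sig S (r + 1)).ncard =
      (MSet Sig (S.erase a) (r + 1)).ncard + (MSet Sig ((S.erase a).erase b) r).ncard := by
  set φ : Finset X → Finset X := fun B => if b ∈ B then insert a B else B with hφ
  set ψ : Finset X → Finset X := fun B => B.erase a with hψ
  have hSA' : ∀ x ∈ S, x ≠ a → x ≠ b → x ∉ A := by
    intro x hx h1 h2 h3
    rcases hSA x hx h3 with h | h <;> contradiction
  -- properties of φ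
  have hψφ : ∀ B : Finset X, a ∉ B → ψ (φ B) = B := by
    intro B hB
    simp only [hφ, hψ]
    split_ifs with h
    · rw [Finset.erase_insert hB]
    · rw [Finset.erase_eq_of_notMem hB]
  have hnot1 : ∀ {r} {P : Finset (Finset X)}, P ∈ MSet Sig (S.erase a) r → ∀ B ∈ P, a ∉ B := by
    intro r P hP B hB haB
    have := (hP.2.2.1 a).2 ⟨B, hB, haB⟩
    simp at this
  have hnot2 : ∀ {r} {P : Finset (Finset X)}, P ∈ MSet Sig ((S.erase a).erase b) r →
      ∀ B ∈ P, a ∉ B ∧ b ∉ B := by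
    intro r P hP B hB
    constructor
    · intro haB
      have := (hP.2.2.1 a).2 ⟨B, hB, haB⟩
      simp at this
    · intro haB
      have := (hP.2.2.1 b).2 ⟨B, hB, haB⟩
      simp at this
  -- same block
  have hsame : ∀ {r} {P : Finset (Finset X)}, P ∈ MSet Sig S r → ∀ B ∈ P, a ∈ B → b ∈ B := by
    intro r P hP B hB haB
    by_contra hbB
    obtain ⟨B', hB', hbB'⟩ := (hP.2.2.1 b).1 hbS
    have hne : B ≠ B' := by rintro rfl; exact hbB hbB'
    obtain ⟨x, hx, hxa⟩ := Finset.exists_mem_ne (hP.2.1 B hB) a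
    obtain ⟨y, hy, hyb⟩ := Finset.exists_mem_ne (hP.2.1 B' hB') b
    have hsep := hP.2.2.2 B hB B' hB' hne
    have hxb : x ≠ b := by rintro rfl; exact hbB hx
    have hya : y ≠ a := by rintro rfl; exact hsep.not_mem haB hy
    have hxA := hSA' x ((hP.2.2.1 x).2 ⟨B, hB, hx⟩) hxa hxb
    have hyA := hSA' y ((hP.2.2.1 y).2 ⟨B', hB', hy⟩) hya hyb
    obtain ⟨C, hC, h1, h2⟩ := hsep
    exact hcompat A hA C hC a b x y haA (h1 a haB) hbA (h2 b hbB') hxA (h1 x hx) hyA (h2 y hy)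
  have hsame' : ∀ {r} {P : Finset (Finset X)}, P ∈ MSet Sig S r → ∀ B ∈ P, b ∈ B → a ∈ B := by
    intro r P hP B hB hbB
    obtain ⟨B', hB', haB'⟩ := (hP.2.2.1 a).1 haS
    have := MSet_uniq hP hB hB' hbB (hsame hP B' hB' haB')
    rw [this]; exact haB'
  have hφψ : ∀ {r} {P : Finset (Finset X)}, P ∈ MSet Sig S r → ∀ B ∈ P, φ (ψ B) = B := by
    intro r P hP B hB
    simp only [hφ, hψ]
    by_cases haB : a ∈ B
    · have hbB := hsame hP B hB haB
      rw [if_pos (by simp [hbB, hab.symm]), Finset.insert_erase haB]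
    · have hbB : b ∉ B := fun h => haB (hsame' hP B hB h)
      rw [if_neg (by simp [hbB]), Finset.erase_eq_of_notMem haB]
  have key : MSet Sig S (r + 1) =
      ((fun P => P.image φ) '' MSet Sig (S.erase a) (r + 1)) ∪
      ((fun P => insert {a, b} P) '' MSet Sig ((S.erase a).erase b) r) := by
    ext P
    constructor
    · intro hP
      by_cases hm : ({a, b} : Finset X) ∈ P
      · right
        refine ⟨P.erase {a, b}, ⟨?_, ?_, ?_, ?_⟩, Finset.insert_erase hm⟩
        · rw [Finset.card_erase_of_mem hm, hP.1]; rfl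
        · intro B hB; exact hP.2.1 B (Finset.mem_of_mem_erase hB)
        · intro x
          constructor
          · intro hx
            simp only [Finset.mem_erase] at hx
            obtain ⟨B, hB, hxB⟩ := (hP.2.2.1 x).1 hx.2.2
            refine ⟨B, Finset.mem_erase.2 ⟨?_, hB⟩, hxB⟩
            rintro rfl
            simp at hxB; tauto
          · rintro ⟨B, hB, hxB⟩
            rw [Finset.mem_erase] at hB
            have hs := hP.2.2.2 B hB.2 _ hm hB.1
            simp only [Finset.mem_erase]
            refine ⟨?_, ?_, (hP.2.2.1 x).2 ⟨B, hB.2, hxB⟩⟩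
            · rintro rfl; exact hs.not_mem hxB (by simp)
            · rintro rfl; exact hs.not_mem hxB (by simp)
        · intro B hB B' hB' hne
          exact hP.2.2.2 B (Finset.mem_of_mem_erase hB) B' (Finset.mem_of_mem_erase hB') hne
      · left
        have hinv : (P.image ψ).image φ = P := by
          rw [Finset.image_image]
          ext B
          simp only [Finset.mem_image, Function.comp]
          constructor
          · rintro ⟨B', hB', rfl⟩
            rw [hφψ hP B' hB']; exact hB'
          · intro hB; exact ⟨B, hB, hφψ hP B hB⟩
        have hinj : Set.InjOn ψ (P : Set (Finset X)) := by
          intro B hB B' hB' h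
          rw [← hφψ hP B hB, ← hφψ hP B' hB', h]
        refine ⟨P.image ψ, ⟨?_, ?_, ?_, ?_⟩, hinv⟩
        · rw [Finset.card_image_of_injOn hinj, hP.1]
        · intro B hB
          obtain ⟨B, hB2, rfl⟩ := Finset.mem_image.1 hB
          have hB := hB2
          by_cases haB : a ∈ B
          · have hbB := hsame hP B hB haB
            have hsub : ({a, b} : Finset X) ⊆ B := by
              intro x hx; simp at hx; rcases hx with rfl | rfl <;> assumption
            have hss : ({a, b} : Finset X) ⊂ B := by
              refine lt_of_le_of_ne hsub ?_
              rintro rfl; exact hm hB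
            have := Finset.card_lt_card hss
            rw [Finset.card_pair hab] at this
            simp only [hψ]
            rw [Finset.card_erase_of_mem haB]; omega
          · simp only [hψ]
            rw [Finset.erase_eq_of_notMem haB]; exact hP.2.1 B hB
        · intro x
          simp only [Finset.mem_erase, Finset.mem_image, hψ]
          constructor
          · rintro ⟨hxa, hx⟩
            obtain ⟨B, hB, hxB⟩ := (hP.2.2.1 x).1 hx
            exact ⟨_, ⟨B, hB, rfl⟩, Finset.mem_erase.2 ⟨hxa, hxB⟩⟩
          · rintro ⟨_, ⟨B, hB, rfl⟩, hx⟩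
            rw [Finset.mem_erase] at hx
            exact ⟨hx.1, (hP.2.2.1 x).2 ⟨B, hB, hx.2⟩⟩
        · intro B hB B' hB' hne
          obtain ⟨B, hB2, rfl⟩ := Finset.mem_image.1 hB
          have hB := hB2
          obtain ⟨B', hB2', rfl⟩ := Finset.mem_image.1 hB'
          have hB' := hB2'
          obtain ⟨C, hC, h1, h2⟩ := hP.2.2.2 B hB B' hB' (by rintro rfl; exact hne rfl)
          exact ⟨C, hC, fun x hx => h1 x (Finset.mem_of_mem_erase hx),
            fun x hx => h2 x (Finset.mem_of_mem_erase hx)⟩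
    · rintro (⟨P, hP, rfl⟩ | ⟨P, hP, rfl⟩)
      · have hinj : Set.InjOn φ (P : Set (Finset X)) := by
          intro B hB B' hB' h
          rw [← hψφ B (hnot1 hP B hB), ← hψφ B' (hnot1 hP B' hB'), h]
        have hsubφ : ∀ B, B ⊆ φ B := by
          intro B; simp only [hφ]; split_ifs
          · exact Finset.subset_insert _ _
          · exact Finset.Subset.refl _
        obtain ⟨B0, hB0, hbB0⟩ := (hP.2.2.1 b).1 (Finset.mem_erase.2 ⟨hab.symm, hbS⟩)
        -- separation with the block containing b
        have hbsep : ∀ B ∈ P, ∀ B' ∈ P, B ≠ B' → b ∈ B → Sepd Sig (insert a B) B' := by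
          intro B hB B' hB' hne hbB
          have hs := hP.2.2.2 B hB B' hB' hne
          have hs' := hs
          obtain ⟨C, hC, h1, h2⟩ := hs
          by_cases haC : a ∈ C
          · exact ⟨C, hC, by simpa [haC] using h1, h2⟩
          · exfalso
            obtain ⟨x, hx, hxb⟩ := Finset.exists_mem_ne (hP.2.1 B hB) b
            have hc : 0 < B'.card := by have := hP.2.1 B' hB'; omega
            obtain ⟨y, hy⟩ := Finset.card_pos.1 hc
            have hxS := Finset.mem_erase.1 ((hP.2.2.1 x).2 ⟨B, hB, hx⟩)
            have hyS := Finset.mem_erase.1 ((hP.2.2.1 y).2 ⟨B', hB', hy⟩)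
            have hyb : y ≠ b := by rintro rfl; exact hs'.not_mem hbB hy
            exact hcompat A hA C hC b a x y hbA (h1 b hbB) haA haC
              (hSA' x hxS.2 hxS.1 hxb) (h1 x hx) (hSA' y hyS.2 hyS.1 hyb) (h2 y hy)
        have hsymm : ∀ B B' : Finset X, Sepd Sig B B' → Sepd Sig B' B := by
          rintro B B' ⟨C, hC, h1, h2⟩
          exact ⟨Cᶜ, hcompl C hC, h2, fun x hx h => h (h1 x hx)⟩
        refine ⟨?_, ?_, ?_, ?_⟩
        · rw [Finset.card_image_of_injOn hinj, hP.1]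
        · intro B hB
          obtain ⟨B, hB2, rfl⟩ := Finset.mem_image.1 hB
          have hB := hB2
          exact (hP.2.1 B hB).trans (Finset.card_le_card (hsubφ B))
        · intro x
          constructor
          · intro hx
            by_cases hxa : x = a
            · refine ⟨φ B0, Finset.mem_image_of_mem _ hB0, ?_⟩
              simp [hφ, hbB0, hxa]
            · obtain ⟨B, hB, hxB⟩ := (hP.2.2.1 x).1 (Finset.mem_erase.2 ⟨hxa, hx⟩)
              exact ⟨φ B, Finset.mem_image_of_mem _ hB, hsubφ B hxB⟩
          · rintro ⟨B, hB, hx⟩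
            obtain ⟨B, hB2, rfl⟩ := Finset.mem_image.1 hB
            have hB := hB2
            by_cases hxa : x = a
            · rw [hxa]; exact haS
            · have : x ∈ B := by
                simp only [hφ] at hx
                split_ifs at hx
                · simpa [hxa] using hx
                · exact hx
              exact Finset.mem_of_mem_erase ((hP.2.2.1 x).2 ⟨B, hB, this⟩)
        · intro B hB B' hB' hne
          obtain ⟨B, hB2, rfl⟩ := Finset.mem_image.1 hB
          have hB := hB2
          obtain ⟨B', hB2', rfl⟩ := Finset.mem_image.1 hB'
          have hB' := hB2'
          have hne' : B ≠ B' := by rintro rfl; exact hne rfl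
          by_cases hbB : b ∈ B
          · have hbB' : b ∉ B' := fun h => hne' (MSet_uniq hP hB hB' hbB h)
            simp only [hφ, if_pos hbB, if_neg hbB']
            exact hbsep B hB B' hB' hne' hbB
          · by_cases hbB' : b ∈ B'
            · simp only [hφ, if_pos hbB', if_neg hbB]
              exact hsymm _ _ (hbsep B' hB' B hB hne'.symm hbB')
            · simp only [hφ, if_neg hbB', if_neg hbB]
              exact hP.2.2.2 B hB B' hB' hne'
      · have hnm : ({a, b} : Finset X) ∉ P := fun h => (hnot2 hP _ h).1 (by simp)
        have hout : ∀ B ∈ P, ∀ x ∈ B, x ∉ A := by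
          intro B hB x hx
          have h := (hP.2.2.1 x).2 ⟨B, hB, hx⟩
          simp only [Finset.mem_erase] at h
          exact hSA' x h.2.2 h.2.1 h.1
        have hin : ∀ x ∈ ({a, b} : Finset X), x ∈ A := by
          intro x hx; simp at hx; rcases hx with rfl | rfl <;> assumption
        refine ⟨?_, ?_, ?_, ?_⟩
        · rw [Finset.card_insert_of_notMem hnm, hP.1]
        · intro B hB
          rcases Finset.mem_insert.1 hB with rfl | hB
          · rw [Finset.card_pair hab]
          · exact hP.2.1 B hB
        · intro x
          constructor
          · intro hx
            by_cases hxab : x = a ∨ x = b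
            · exact ⟨{a, b}, by simp, by simpa using hxab⟩
            · push Not at hxab
              obtain ⟨B, hB, hxB⟩ := (hP.2.2.1 x).1 (by simp [hx, hxab])
              exact ⟨B, by simp [hB], hxB⟩
          · rintro ⟨B, hB, hx⟩
            rcases Finset.mem_insert.1 hB with rfl | hB
            · simp at hx; rcases hx with rfl | rfl <;> assumption
            · have h := (hP.2.2.1 x).2 ⟨B, hB, hx⟩
              simp only [Finset.mem_erase] at h
              exact h.2.2
        · intro B hB B' hB' hne
          rcases Finset.mem_insert.1 hB with rfl | hB
          · rcases Finset.mem_insert.1 hB' with rfl | hB'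
            · exact absurd rfl hne
            · exact ⟨A, hA, hin, hout B' hB'⟩
          · rcases Finset.mem_insert.1 hB' with rfl | hB'
            · exact ⟨Aᶜ, hcompl A hA, hout B hB, fun x hx h => h (hin x hx)⟩
            · exact hP.2.2.2 B hB B' hB' hne
  rw [key, Set.ncard_union_eq ?_ (Set.toFinite _) (Set.toFinite _)]
  · congr 1
    · refine Set.InjOn.ncard_image ?_
      intro P hP P' hP' h
      have hback : ∀ Q ∈ MSet Sig (S.erase a) (r + 1), (Q.image φ).image ψ = Q := by
        intro Q hQ
        rw [Finset.image_image]
        ext B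
        simp only [Finset.mem_image, Function.comp]
        constructor
        · rintro ⟨B', hB', rfl⟩
          rw [hψφ B' (hnot1 hQ B' hB')]; exact hB'
        · intro hB; exact ⟨B, hB, hψφ B (hnot1 hQ B hB)⟩
      rw [← hback P hP, ← hback P' hP']
      exact congrArg (Finset.image ψ) h
    · refine Set.InjOn.ncard_image ?_
      intro P hP P' hP' h
      have hnm : ∀ Q ∈ MSet Sig ((S.erase a).erase b) r, ({a, b} : Finset X) ∉ Q :=
        fun Q hQ h => (hnot2 hQ _ h).1 (by simp)
      have h' : insert {a, b} P = insert {a, b} P' := h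
      rw [← Finset.erase_insert (hnm P hP), ← Finset.erase_insert (hnm P' hP'), h']
  · rw [Set.disjoint_left]
    rintro Q ⟨P, hP, rfl⟩ ⟨P', hP', h⟩
    have h' : insert {a, b} P' = P.image φ := h
    have : ({a, b} : Finset X) ∈ P.image φ := by rw [← h']; simp
    obtain ⟨B, hB, hBe⟩ := Finset.mem_image.1 this
    have hh := hψφ B (hnot1 hP B hB)
    rw [hBe] at hh
    have h2 := hP.2.1 B hB
    rw [← hh] at h2
    simp only [hψ] at h2
    rw [Finset.card_erase_of_mem (by simp), Finset.card_pair hab] at h2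
    omega

theorem MSet_count [Finite X]
    (hcompl : ∀ A ∈ Sig, Aᶜ ∈ Sig)
    (hcompat : ∀ A ∈ Sig, ∀ C ∈ Sig, ∀ w x y z : X, w ∈ A → w ∈ C → x ∈ A → x ∉ C →
      y ∉ A → y ∈ C → z ∉ A → z ∉ C → False)
    (hcherry : ∀ S : Finset X, 2 ≤ S.card → ∃ A ∈ Sig, ∃ a ∈ S, ∃ b ∈ S, a ≠ b ∧ a ∈ A ∧ b ∈ A ∧
      ∀ x ∈ S, x ∈ A → x = a ∨ x = b) (n : ℕ) :
    ∀ (S : Finset X) (r : ℕ), S.card = n → (MSet Sig S r).ncard = FRec n r := by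
  classical
  have hzero : ∀ S : Finset X, S.Nonempty → (MSet Sig S 0).ncard = 0 := by
    intro S ⟨x, hx⟩
    rw [Set.ncard_eq_zero (Set.toFinite _)]
    ext P
    simp only [Set.mem_empty_iff_false, iff_false]
    intro hP
    obtain ⟨B, hB, _⟩ := (hP.2.2.1 x).1 hx
    rw [Finset.card_eq_zero.1 hP.1] at hB
    simp at hB
  induction n using Nat.strong_induction_on with
  | _ n ih =>
    intro S r hS
    match n, r, ih, hS with
    | 0, 0, _, hS =>
      rw [Finset.card_eq_zero] at hS
      subst hS
      have : MSet Sig ∅ 0 = {∅} := by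
        ext P
        simp only [Set.mem_singleton_iff]
        constructor
        · intro hP; exact Finset.card_eq_zero.1 hP.1
        · rintro rfl; exact ⟨by simp, by simp, by simp, by simp⟩
      rw [this]; simp [FRec]
    | 0, r + 1, _, hS =>
      rw [Finset.card_eq_zero] at hS
      subst hS
      simp only [FRec]
      rw [Set.ncard_eq_zero (Set.toFinite _)]
      ext P
      simp only [Set.mem_empty_iff_false, iff_false]
      intro hP
      have hc : 0 < P.card := by rw [hP.1]; omega
      obtain ⟨B, hB⟩ := Finset.card_pos.1 hc
      have hc : 0 < B.card := by have := hP.2.1 B hB; omega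
      obtain ⟨x, hx⟩ := Finset.card_pos.1 hc
      have := (hP.2.2.1 x).2 ⟨B, hB, hx⟩
      simp at this
    | 1, r, _, hS =>
      obtain ⟨s, rfl⟩ := Finset.card_eq_one.1 hS
      simp only [FRec]
      rw [Set.ncard_eq_zero (Set.toFinite _)]
      ext P
      simp only [Set.mem_empty_iff_false, iff_false]
      intro hP
      obtain ⟨B, hB, hsB⟩ := (hP.2.2.1 s).1 (by simp)
      obtain ⟨x, hx, hxs⟩ := Finset.exists_mem_ne (hP.2.1 B hB) s
      have := (hP.2.2.1 x).2 ⟨B, hB, hx⟩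
      simp at this; exact hxs this
    | n + 2, 0, _, hS =>
      rw [hzero S (Finset.card_pos.1 (by omega))]; simp [FRec]
    | n + 2, r + 1, ih, hS =>
      obtain ⟨A, hA, a, ha, b, hb, hab, haA, hbA, hSA⟩ := hcherry S (by omega)
      rw [MSet_step Sig hcompl hcompat S A hA a b hab ha hb haA hbA hSA r, FRec]
      have c1 : (S.erase a).card = n + 1 := by rw [Finset.card_erase_of_mem ha]; omega
      have c2 : ((S.erase a).erase b).card = n := by
        rw [Finset.card_erase_of_mem (Finset.mem_erase.2 ⟨hab.symm, hb⟩)]; omega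
      rw [ih (n + 1) (by omega) _ _ c1, ih n (by omega) _ _ c2]

end Count

section Tree
variable {V : Type} {G : SimpleGraph V}

/-- A vertex set which is connected (possibly empty), phrased with walks. -/
def CSet (G : SimpleGraph V) (s : Set V) : Prop :=
  ∀ x ∈ s, ∀ y ∈ s, ∃ p : G.Walk x y, ∀ z ∈ p.support, z ∈ s

theorem CSet_of_preconnected {s : Set V} (h : (G.induce s).Preconnected) : CSet G s := by
  intro x hx y hy
  obtain ⟨p⟩ := h ⟨x, hx⟩ ⟨y, hy⟩
  refine ⟨p.map (SimpleGraph.Embedding.induce s).toHom, ?_⟩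
  intro z hz
  have hz2 := (congrArg (z ∈ ·) (SimpleGraph.Walk.support_map
    (SimpleGraph.Embedding.induce s).toHom p)).mp hz
  obtain ⟨w, _, rfl⟩ := List.mem_map.1 hz2
  exact w.2

theorem CSet.preconnected {s : Set V} (h : CSet G s) : (G.induce s).Preconnected := by
  rintro ⟨x, hx⟩ ⟨y, hy⟩
  obtain ⟨p, hp⟩ := h x hx y hy
  exact ⟨p.induce s hp⟩

/-- To be connected it suffices to reach a base point. -/
theorem CSet_of_base {s : Set V} (c : V)
    (h : ∀ x ∈ s, ∃ p : G.Walk x c, ∀ z ∈ p.support, z ∈ s) : CSet G s := by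
  intro x hx y hy
  obtain ⟨p, hp⟩ := h x hx
  obtain ⟨q, hq⟩ := h y hy
  refine ⟨p.append q.reverse, ?_⟩
  intro z hz
  rw [SimpleGraph.Walk.mem_support_append_iff] at hz
  rcases hz with hz | hz
  · exact hp z hz
  · rw [SimpleGraph.Walk.support_reverse, List.mem_reverse] at hz
    exact hq z hz

theorem CSet.insert' {s : Set V} (h : CSet G s) {u v : V} (hu : u ∈ s) (ha : G.Adj u v) :
    CSet G (insert v s) := by
  apply CSet_of_base u
  rintro x (rfl | hx)
  · refine ⟨SimpleGraph.Walk.cons ha.symm SimpleGraph.Walk.nil, ?_⟩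
    intro z hz
    simp at hz
    rcases hz with rfl | rfl
    · exact Set.mem_insert _ _
    · exact Set.mem_insert_of_mem _ hu
  · obtain ⟨p, hp⟩ := h x hx u hu
    exact ⟨p, fun z hz => Set.mem_insert_of_mem _ (hp z hz)⟩

theorem walk_cross {x y : V} (p : G.Walk x y) {C : Set V} (hx : x ∈ C) (hy : y ∉ C) :
    ∃ c c', G.Adj c c' ∧ c ∈ p.support ∧ c' ∈ p.support ∧ c ∈ C ∧ c' ∉ C := by
  obtain ⟨d, hd, h1, h2⟩ := p.exists_boundary_dart C hx hy
  exact ⟨d.fst, d.snd, d.adj, p.dart_fst_mem_support_of_mem_darts hd,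
    p.dart_snd_mem_support_of_mem_darts hd, h1, h2⟩

theorem cut_unique (hG : G.IsAcyclic) {C : Set V} (hC : CSet G C) (hC' : CSet G Cᶜ)
    {p q p' q' : V} (hp : p ∈ C) (hq : q ∉ C) (hp' : p' ∈ C) (hq' : q' ∉ C)
    (h : G.Adj p q) (h' : G.Adj p' q') : p = p' ∧ q = q' := by
  have hb := SimpleGraph.isAcyclic_iff_forall_adj_isBridge.1 hG h
  rw [SimpleGraph.isBridge_iff_forall_walk_mem_edges] at hb
  obtain ⟨w1, hw1⟩ := hC p hp p' hp'
  obtain ⟨w2, hw2⟩ := hC' q' hq' q hq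
  have hm := hb (w1.append (SimpleGraph.Walk.cons h' w2))
  rw [SimpleGraph.Walk.edges_append, List.mem_append, SimpleGraph.Walk.edges_cons,
    List.mem_cons] at hm
  rcases hm with hm | hm | hm
  · exact absurd (hw1 q (w1.snd_mem_support_of_mem_edges hm)) hq
  · rw [Sym2.eq_iff] at hm
    rcases hm with hm | hm
    · exact hm
    · exact absurd (hm.1 ▸ hp) hq'
  · exact absurd hp (hw2 p (w2.fst_mem_support_of_mem_edges hm))

/-- The component of `d` in the complement of `D`. -/
def KSet (G : SimpleGraph V) (D : Set V) (d : V) : Set V :=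
  {z | ∃ p : G.Walk z d, ∀ w ∈ p.support, w ∉ D}

theorem KSet_not_mem {D : Set V} {d z : V} (h : z ∈ KSet G D d) : z ∉ D := by
  obtain ⟨p, hp⟩ := h
  exact hp z p.start_mem_support

theorem KSet_base {D : Set V} {d : V} (h : d ∉ D) : d ∈ KSet G D d :=
  ⟨SimpleGraph.Walk.nil, by simpa using h⟩

theorem KSet_adj {D : Set V} {d x y : V} (hxy : G.Adj x y) (hx : x ∉ D) (hy : y ∈ KSet G D d) :
    x ∈ KSet G D d := by
  obtain ⟨p, hp⟩ := hy
  refine ⟨SimpleGraph.Walk.cons hxy p, ?_⟩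
  intro w hw
  rw [SimpleGraph.Walk.support_cons, List.mem_cons] at hw
  rcases hw with rfl | hw
  · exact hx
  · exact hp w hw

theorem KSet_support {D : Set V} {d z : V} (p : G.Walk z d) (hp : ∀ w ∈ p.support, w ∉ D) :
    ∀ w ∈ p.support, w ∈ KSet G D d := by
  induction p with
  | nil =>
    intro w hw
    simp at hw
    subst hw
    exact KSet_base (hp _ (by simp))
  | cons h p ih =>
    intro w hw
    have ih' := ih (fun w hw => hp w (by simp [hw]))
    rw [SimpleGraph.Walk.support_cons, List.mem_cons] at hw
    rcases hw with rfl | hw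
    · exact KSet_adj h (hp _ (by simp)) (ih' _ p.start_mem_support)
    · exact ih' w hw

theorem KSet_CSet {D : Set V} {d : V} : CSet G (KSet G D d) := by
  apply CSet_of_base d
  intro x hx
  obtain ⟨p, hp⟩ := hx
  exact ⟨p, KSet_support p hp⟩

theorem KSet_compl_CSet (hG : G.Connected) {D : Set V} (hD : CSet G D) {c d : V} (hc : c ∈ D) :
    CSet G (KSet G D d)ᶜ := by
  apply CSet_of_base c
  intro x hx
  obtain ⟨p⟩ := hG.preconnected x c
  induction p with
  | nil => exact ⟨SimpleGraph.Walk.nil, by simpa using hx⟩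
  | @cons u v w h p ih =>
    by_cases hu : u ∈ D
    · obtain ⟨q, hq⟩ := hD u hu w hc
      exact ⟨q, fun z hz hK => KSet_not_mem hK (hq z hz)⟩
    · have hv : v ∈ (KSet G D d)ᶜ := fun hK => hx (KSet_adj h hu hK)
      obtain ⟨q, hq⟩ := ih hc hv
      refine ⟨SimpleGraph.Walk.cons h q, ?_⟩
      intro z hz
      rw [SimpleGraph.Walk.support_cons, List.mem_cons] at hz
      rcases hz with rfl | hz
      · exact hx
      · exact hq z hz

theorem CSet_iInter (hG : G.IsAcyclic) (F : Set (Set V)) (hF : ∀ s ∈ F, CSet G s) (hne : F.Nonempty) :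
    CSet G (⋂₀ F) := by
  classical
  intro x hx y hy
  obtain ⟨s0, hs0⟩ := hne
  obtain ⟨p0, _⟩ := hF s0 hs0 x (hx s0 hs0) y (hy s0 hs0)
  refine ⟨p0.bypass, ?_⟩
  intro z hz s hs
  obtain ⟨p, hp⟩ := hF s hs x (hx s hs) y (hy s hs)
  have := (hG.subsingleton_path x y).elim ⟨p0.bypass, p0.bypass_isPath⟩
    ⟨p.bypass, p.bypass_isPath⟩
  have h' : p0.bypass = p.bypass := congrArg Subtype.val this
  rw [h'] at hz
  exact hp z (p.support_bypass_subset_support hz)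

/-- Extending a partial assignment to all the vertices. -/
theorem extend_assign [Finite V] {L : Type} (hG : G.Connected) (P : Set L) (U : Set V) (h : V → L)
    (hU : U.Nonempty) (hP : ∀ v ∈ U, h v ∈ P) (hc : ∀ B ∈ P, CSet G {v | v ∈ U ∧ h v = B}) :
    ∃ h' : V → L, (∀ v, h' v ∈ P) ∧ (∀ v ∈ U, h' v = h v) ∧ ∀ B ∈ P, CSet G {v | h' v = B} := by
  classical
  induction hm : (Uᶜ).ncard using Nat.strong_induction_on generalizing U h with
  | _ m ih =>
    by_cases hall : ∀ v, v ∈ U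
    · refine ⟨h, fun v => hP v (hall v), fun _ _ => rfl, ?_⟩
      intro B hB
      have := hc B hB
      simpa [hall] using this
    · push Not at hall
      obtain ⟨y, hy⟩ := hall
      obtain ⟨x, hx⟩ := hU
      obtain ⟨p⟩ := hG.preconnected x y
      obtain ⟨c, c', hadj, _, _, hcU, hcU'⟩ := walk_cross p hx hy
      have hne : ∀ v ∈ U, v ≠ c' := by rintro v hv rfl; exact hcU' hv
      obtain ⟨h', h1, h2, h3⟩ := ih ((insert c' U)ᶜ).ncard
        (by
          rw [← hm]
          apply Set.ncard_lt_ncard _ (Set.toFinite _)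
          refine ⟨?_, ?_⟩
          · intro z hz hzU; exact hz (Set.mem_insert_of_mem _ hzU)
          · intro hsub; exact hsub hcU' (Set.mem_insert _ _))
        (insert c' U) (Function.update h c' (h c)) ⟨c', Set.mem_insert _ _⟩
        (by
          rintro v (rfl | hv)
          · simpa using hP c hcU
          · rw [Function.update_of_ne (hne v hv)]; exact hP v hv)
        (by
          intro B hB
          by_cases hcB : h c = B
          · have := (hc B hB).insert' (u := c) (v := c') ⟨hcU, hcB⟩ hadj
            convert this using 1
            ext v
            simp only [Set.mem_ofPred_eq, Set.mem_insert_iff]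
            by_cases hv : v = c'
            · subst hv; simp [hcB]
            · simp [hv]
          · have := hc B hB
            convert this using 1
            ext v
            simp only [Set.mem_ofPred_eq, Set.mem_insert_iff]
            by_cases hv : v = c'
            · subst hv; simp [hcB, hcU']
            · simp [hv])
        rfl
      refine ⟨h', h1, ?_, h3⟩
      intro v hv
      rw [h2 v (Set.mem_insert_of_mem _ hv), Function.update_of_ne (hne v hv)]

/-- The splits of a tree: vertex sets which are connected with connected complement. -/
def BiC (G : SimpleGraph V) (A : Set V) : Prop := CSet G A ∧ CSet G Aᶜ

theorem BiC.compl {A : Set V} (h : BiC G A) : BiC G Aᶜ := ⟨h.2, by rw [compl_compl]; exact h.1⟩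

theorem BiC_compat (hG : G.IsAcyclic) {A C : Set V} (hA : BiC G A) (hC : BiC G C) {w x y z : V}
    (h1 : w ∈ A) (h2 : w ∈ C) (h3 : x ∈ A) (h4 : x ∉ C) (h5 : y ∉ A) (h6 : y ∈ C)
    (h7 : z ∉ A) (h8 : z ∉ C) : False := by
  obtain ⟨p, hp⟩ := hA.1 w h1 x h3
  obtain ⟨q, hq⟩ := hA.2 y h5 z h7
  obtain ⟨c, c', hcc, hc, _, hcC, hcC'⟩ := walk_cross p h2 h4
  obtain ⟨d, d', hdd, hd, _, hdC, hdC'⟩ := walk_cross q h6 h8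
  have := (cut_unique hG hC.1 hC.2 hcC hcC' hdC hdC' hcc hdd).1
  subst this
  exact hq c hd (hp c hc)

theorem BiC_KSet (hG : G.Connected) {D : Set V} (hD : CSet G D) {c d : V} (hc : c ∈ D) :
    BiC G (KSet G D d) := ⟨KSet_CSet, KSet_compl_CSet hG hD hc⟩

end Tree

section Final
variable {V X : Type}

theorem KSet_cover {G : SimpleGraph V} {A : Set V} (hA : CSet G A) {u z : V} (hu : u ∈ A)
    (hz : z ∈ A) (hne : z ≠ u) : ∃ w ∈ A, G.Adj u w ∧ z ∈ KSet G {u} w := by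
  classical
  obtain ⟨p, hp⟩ := hA u hu z hz
  have hpath := p.bypass_isPath
  have hsup : ∀ w ∈ p.bypass.support, w ∈ A :=
    fun w hw => hp w (p.support_bypass_subset_support hw)
  revert hpath hsup
  generalize p.bypass = q
  intro hpath hsup
  cases q with
  | nil => exact absurd rfl hne
  | @cons _ w _ h q =>
    rw [SimpleGraph.Walk.cons_isPath_iff] at hpath
    refine ⟨w, hsup w (by simp), h, q.reverse, ?_⟩
    intro y hy hyu
    rw [SimpleGraph.Walk.support_reverse, List.mem_reverse] at hy
    rw [Set.mem_singleton_iff] at hyu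
    subst hyu
    exact hpath.2 hy

theorem CSet_univ {G : SimpleGraph V} (hG : G.Connected) : CSet G Set.univ := by
  intro x _ y _
  obtain ⟨p⟩ := hG.preconnected x y
  exact ⟨p, fun _ _ => trivial⟩

theorem BiC_univ {G : SimpleGraph V} (hG : G.Connected) : BiC G Set.univ :=
  ⟨CSet_univ hG, by intro x hx; simp at hx⟩

theorem CSet_singleton {G : SimpleGraph V} (u : V) : CSet G {u} := by
  rintro x rfl y rfl
  exact ⟨SimpleGraph.Walk.nil, by simp⟩

/-- The split system of a phylogenetic tree. -/
def SigT (T : UnrootedBinaryTree V X) : Set (Set X) :=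
  {A | ∃ C, BiC T.graph C ∧ A = T.label ⁻¹' C}

theorem cherry_exists [Finite V] (T : UnrootedBinaryTree V X) (S : Finset X) (hS : 2 ≤ S.card) :
    ∃ A ∈ SigT T, ∃ a ∈ S, ∃ b ∈ S, a ≠ b ∧ a ∈ A ∧ b ∈ A ∧
      ∀ x ∈ S, x ∈ A → x = a ∨ x = b := by
  classical
  have hconn := T.isTree.connected
  have hacyc := T.isTree.isAcyclic
  suffices h : ∃ C, BiC T.graph C ∧ (S.filter (fun x => T.label x ∈ C)).card = 2 by
    obtain ⟨C, hC, hcard⟩ := h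
    obtain ⟨a, b, hab, he⟩ := Finset.card_eq_two.1 hcard
    have hmem : ∀ x, (x ∈ S ∧ T.label x ∈ C) ↔ (x = a ∨ x = b) := by
      intro x
      have : x ∈ S.filter (fun x => T.label x ∈ C) ↔ x ∈ ({a, b} : Finset X) := by rw [he]
      simpa using this
    have ha := (hmem a).2 (Or.inl rfl)
    have hb := (hmem b).2 (Or.inr rfl)
    exact ⟨_, ⟨C, hC, rfl⟩, a, ha.1, b, hb.1, hab, ha.2, hb.2,
      fun x hx hxC => (hmem x).1 ⟨hx, hxC⟩⟩
  rcases hS.eq_or_lt with h2 | h3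
  · exact ⟨Set.univ, BiC_univ hconn, by simp [← h2]⟩
  set F : Set (Set V) := {C | BiC T.graph C ∧ (∃ v, v ∉ C) ∧
    2 ≤ (S.filter (fun x => T.label x ∈ C)).card} with hF
  have hFne : F.Nonempty := by
    obtain ⟨x0, hx0⟩ := Finset.card_pos.1 (by omega : 0 < S.card)
    obtain ⟨d, hd⟩ := Set.ncard_eq_one.1 (T.label_leaf x0)
    refine ⟨KSet T.graph {T.label x0} d, BiC_KSet hconn (CSet_singleton _) rfl,
      ⟨T.label x0, fun h => KSet_not_mem h rfl⟩, ?_⟩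
    have hsub : S.erase x0 ⊆ S.filter (fun x => T.label x ∈ KSet T.graph {T.label x0} d) := by
      intro x hx
      rw [Finset.mem_erase] at hx
      rw [Finset.mem_filter]
      refine ⟨hx.2, ?_⟩
      obtain ⟨w, _, hadj, hw⟩ := KSet_cover (CSet_univ hconn) (Set.mem_univ (T.label x0))
        (Set.mem_univ (T.label x)) (fun h => hx.1 (T.label_inj h))
      have hwd : w ∈ T.graph.neighborSet (T.label x0) := hadj
      rw [hd, Set.mem_singleton_iff] at hwd
      rw [← hwd]; exact hw
    have := Finset.card_le_card hsub
    rw [Finset.card_erase_of_mem hx0] at this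
    omega
  obtain ⟨C, ⟨hC, ⟨v0, hv0⟩, hcard⟩, hmin⟩ :=
    Set.exists_min_image F Set.ncard (Set.toFinite _) hFne
  refine ⟨C, hC, le_antisymm ?_ hcard⟩
  obtain ⟨x1, hx1⟩ := Finset.card_pos.1
    (by omega : 0 < (S.filter (fun x => T.label x ∈ C)).card)
  have hx1C := (Finset.mem_filter.1 hx1).2
  obtain ⟨p⟩ := hconn.preconnected (T.label x1) v0
  obtain ⟨u, v, huv, _, _, huC, hvC⟩ := walk_cross p hx1C hv0
  have hnb : ∀ w, T.graph.Adj u w → w ≠ v → w ∈ C := by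
    intro w hw hwv
    by_contra hwC
    exact hwv (cut_unique hacyc hC.1 hC.2 huC hwC huC hvC hw huv).2
  have hsmall : ∀ w, T.graph.Adj u w → w ≠ v →
      (S.filter (fun x => T.label x ∈ KSet T.graph {u} w)).card ≤ 1 := by
    intro w hw hwv
    have hwC := hnb w hw hwv
    have hsub : KSet T.graph {u} w ⊂ C := by
      refine ⟨?_, fun h => KSet_not_mem (h huC) rfl⟩
      intro z hz
      obtain ⟨q, hq⟩ := hz
      by_contra hzC
      obtain ⟨c, c', hcc, _, hc', hcC, hcC'⟩ := walk_cross q (C := Cᶜ) hzC (fun h => h hwC)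
      have hcC2 : c' ∈ C := by simpa using hcC'
      have := (cut_unique hacyc hC.1 hC.2 hcC2 hcC huC hvC hcc.symm huv).1
      exact hq c' hc' this
    by_contra hgt
    have := hmin (KSet T.graph {u} w) ⟨BiC_KSet hconn (CSet_singleton _) rfl,
      ⟨u, fun h => KSet_not_mem h rfl⟩, by omega⟩
    have := Set.ncard_lt_ncard hsub (Set.toFinite _)
    omega
  rcases T.degOneOrThree u with hdeg | hdeg
  · obtain ⟨d, hd⟩ := Set.ncard_eq_one.1 hdeg
    have hall : ∀ w, T.graph.Adj u w → w = d := by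
      intro w hw
      have : w ∈ T.graph.neighborSet u := hw
      rw [hd] at this; exact this
    have hCu : ∀ z ∈ C, z = u := by
      intro z hz
      by_contra hzu
      obtain ⟨w, hwC, hadj, _⟩ := KSet_cover hC.1 huC hz hzu
      rw [hall w hadj, ← hall v huv] at hwC
      exact hvC hwC
    refine le_trans (Finset.card_le_one.2 ?_) one_le_two
    intro x hx y hy
    apply T.label_inj
    rw [hCu _ (Finset.mem_filter.1 hx).2, hCu _ (Finset.mem_filter.1 hy).2]
  · have hw : ∃ w1 w2, T.graph.Adj u w1 ∧ w1 ≠ v ∧ T.graph.Adj u w2 ∧ w2 ≠ v ∧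
        ∀ w, T.graph.Adj u w → w = v ∨ w = w1 ∨ w = w2 := by
      obtain ⟨x, y, z, hxy, hxz, hyz, he⟩ := Set.ncard_eq_three.1 hdeg
      have hiff : ∀ w, T.graph.Adj u w ↔ w = x ∨ w = y ∨ w = z := by
        intro w
        have : w ∈ T.graph.neighborSet u ↔ w ∈ ({x, y, z} : Set V) := by rw [he]
        simpa using this
      rcases (hiff v).1 huv with rfl | rfl | rfl
      · exact ⟨y, z, (hiff _).2 (by simp), hxy.symm, (hiff _).2 (by simp), hxz.symm,
          fun w hw => (hiff w).1 hw⟩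
      · exact ⟨x, z, (hiff _).2 (by simp), hxy, (hiff _).2 (by simp), hyz.symm,
          fun w hw => by have := (hiff w).1 hw; tauto⟩
      · exact ⟨x, y, (hiff _).2 (by simp), hxz, (hiff _).2 (by simp), hyz,
          fun w hw => by have := (hiff w).1 hw; tauto⟩
    obtain ⟨w1, w2, ha1, hn1, ha2, hn2, hall⟩ := hw
    have hsub : S.filter (fun x => T.label x ∈ C) ⊆
        S.filter (fun x => T.label x ∈ KSet T.graph {u} w1) ∪
        S.filter (fun x => T.label x ∈ KSet T.graph {u} w2) := by
      intro x hx
      rw [Finset.mem_filter] at hx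
      have hxu : T.label x ≠ u := by
        intro h
        have := T.label_leaf x
        rw [h] at this
        omega
      obtain ⟨w, hwC, hadj, hK⟩ := KSet_cover hC.1 huC hx.2 hxu
      rw [Finset.mem_union, Finset.mem_filter, Finset.mem_filter]
      rcases hall w hadj with rfl | rfl | rfl
      · exact absurd hwC hvC
      · exact Or.inl ⟨hx.1, hK⟩
      · exact Or.inr ⟨hx.1, hK⟩
    have h1 := Finset.card_le_card hsub
    have h2 := Finset.card_union_le (S.filter (fun x => T.label x ∈ KSet T.graph {u} w1))
      (S.filter (fun x => T.label x ∈ KSet T.graph {u} w2))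
    have h3 := hsmall w1 ha1 hn1
    have h4 := hsmall w2 ha2 hn2
    omega

theorem convex_sepd (T : UnrootedBinaryTree V X) {P : Finset (Finset X)}
    (hP : IsConvexChar T P) : ∀ B ∈ P, ∀ B' ∈ P, B ≠ B' → Sepd (SigT T) B B' := by
  intro B hB B' hB' hne
  obtain ⟨h, _, h2, h3⟩ := hP
  obtain ⟨c, hc⟩ := (h3 B hB).nonempty
  obtain ⟨d, hd⟩ := (h3 B' hB').nonempty
  have cD := CSet_of_preconnected (h3 B hB).preconnected
  have cD' := CSet_of_preconnected (h3 B' hB').preconnected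
  refine ⟨_, ⟨(KSet T.graph {v | h v = B} d)ᶜ,
    (BiC_KSet T.isTree.connected cD hc).compl, rfl⟩, ?_, ?_⟩
  · intro x hx hK
    exact KSet_not_mem hK (h2 x B hB hx)
  · intro x hx hK
    apply hK
    obtain ⟨p, hp⟩ := cD' (T.label x) (h2 x B' hB' hx) d hd
    refine ⟨p, ?_⟩
    intro w hw hwB
    have e1 : h w = B := hwB
    have e2 : h w = B' := hp w hw
    exact hne (e1.symm.trans e2)

theorem sepd_convex [Finite V] [Nonempty X] (T : UnrootedBinaryTree V X) {P : Finset (Finset X)}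
    (hne : ∀ B ∈ P, B.Nonempty) (hcov : ∀ x, ∃ B ∈ P, x ∈ B)
    (hP : ∀ B ∈ P, ∀ B' ∈ P, B ≠ B' → Sepd (SigT T) B B') : IsConvexChar T P := by
  classical
  have hconn := T.isTree.connected
  set H : Finset X → Set V :=
    fun B => ⋂₀ {C | BiC T.graph C ∧ ∀ x ∈ B, T.label x ∈ C} with hH
  have hHB : ∀ B, ∀ x ∈ B, T.label x ∈ H B := by
    intro B x hx C hC
    exact hC.2 x hx
  have hHc : ∀ B, CSet T.graph (H B) := by
    intro B
    exact CSet_iInter T.isTree.isAcyclic _ (fun s hs => hs.1.1)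
      ⟨Set.univ, BiC_univ hconn, fun _ _ => trivial⟩
  have hdisj : ∀ B ∈ P, ∀ B' ∈ P, ∀ v, v ∈ H B → v ∈ H B' → B = B' := by
    intro B hB B' hB' v hv hv'
    by_contra hBB
    obtain ⟨_, ⟨C, hC, rfl⟩, h1, h2⟩ := hP B hB B' hB' hBB
    exact hv' Cᶜ ⟨hC.compl, h2⟩ (hv C ⟨hC, h1⟩)
  set U : Set V := {v | ∃ B ∈ P, v ∈ H B} with hU
  set h : V → Finset X := fun v => if hv : ∃ B ∈ P, v ∈ H B then hv.choose else ∅ with hh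
  have hspec : ∀ v ∈ U, h v ∈ P ∧ v ∈ H (h v) := by
    intro v hv
    have hv' : ∃ B ∈ P, v ∈ H B := hv
    simp only [hh, dif_pos hv']
    exact hv'.choose_spec
  have hval : ∀ B ∈ P, ∀ v ∈ H B, h v = B := by
    intro B hB v hv
    have := hspec v ⟨B, hB, hv⟩
    exact hdisj _ this.1 B hB v this.2 hv
  obtain ⟨x0⟩ := ‹Nonempty X›
  obtain ⟨B0, hB0, hx0⟩ := hcov x0
  obtain ⟨h', g1, g2, g3⟩ := extend_assign hconn (P : Set (Finset X)) U h
    ⟨T.label x0, B0, hB0, hHB B0 x0 hx0⟩ (fun v hv => (hspec v hv).1)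
    (by
      intro B hB
      have hB' : B ∈ P := hB
      have he : {v | v ∈ U ∧ h v = B} = H B := by
        ext v
        constructor
        · rintro ⟨hv, rfl⟩; exact (hspec v hv).2
        · intro hv; exact ⟨⟨B, hB', hv⟩, hval B hB' v hv⟩
      rw [he]; exact hHc B)
  have glab : ∀ (x : X) (B : Finset X), B ∈ P → x ∈ B → h' (T.label x) = B := by
    intro x B hB hx
    rw [g2 _ ⟨B, hB, hHB B x hx⟩]
    exact hval B hB _ (hHB B x hx)
  refine ⟨h', g1, glab, ?_⟩
  intro B hB
  obtain ⟨x, hx⟩ := hne B hB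
  have hnon : Nonempty {v | h' v = B} := ⟨⟨T.label x, glab x B hB hx⟩⟩
  exact { preconnected := (g3 B hB).preconnected, nonempty := hnon }

end Final

/-- the number of convex characters on `T` with exactly `r` states,
each appearing on at least 2 taxa, is `C(n-r-1, r-1)`, independent of topology. -/
theorem g2_count_eq_choose {V X : Type} [Finite V] [Finite X]
    (T : UnrootedBinaryTree V X) (n r : ℕ) (hn : Nat.card X = n)
    (hn2 : 2 ≤ n) (hr : 1 ≤ r) :
    gCount T 2 r = Nat.choose (n - r - 1) (r - 1) := by

  classical
  have : Fintype X := Fintype.ofFinite X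
  have : Nonempty X := by
    apply Finite.card_pos_iff.1
    omega
  have hset : {P : Finset (Finset X) | IsCharacter P ∧ IsConvexChar T P ∧ P.card = r ∧
      ∀ B ∈ P, 2 ≤ B.card} = MSet (SigT T) Finset.univ r := by
    ext P
    constructor
    · rintro ⟨h1, h2, h3, h4⟩
      exact ⟨h3, h4, fun x => ⟨fun _ => h1.2.2 x, fun _ => Finset.mem_univ x⟩, convex_sepd T h2⟩
    · rintro ⟨h1, h2, h3, h4⟩
      have hne : ∀ B ∈ P, B.Nonempty := by
        intro B hB
        have := h2 B hB
        exact Finset.card_pos.1 (by omega)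
      have hcov : ∀ x, ∃ B ∈ P, x ∈ B := fun x => (h3 x).1 (Finset.mem_univ x)
      refine ⟨⟨hne, ?_, hcov⟩, sepd_convex T hne hcov h4, h1, h2⟩
      intro B hB B' hB' hBB
      rw [Finset.disjoint_left]
      intro x hx hx'
      exact (h4 B hB B' hB' hBB).not_mem hx hx'
  have hcount := MSet_count (SigT T)
    (by
      rintro _ ⟨C, hC, rfl⟩
      exact ⟨Cᶜ, hC.compl, rfl⟩)
    (by
      rintro _ ⟨A, hA, rfl⟩ _ ⟨C, hC, rfl⟩ w x y z h1 h2 h3 h4 h5 h6 h7 h8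
      exact BiC_compat T.isTree.isAcyclic hA hC h1 h2 h3 h4 h5 h6 h7 h8)
    (cherry_exists T) n Finset.univ r (by rw [Finset.card_univ, ← Nat.card_eq_fintype_card, hn])
  have hg : gCount T 2 r = (MSet (SigT T) Finset.univ r).ncard := by
    rw [← hset]; rfl
  rw [hg, hcount]
  obtain ⟨m, rfl⟩ : ∃ m, n = m + 2 := ⟨n - 2, by omega⟩
  obtain ⟨s, rfl⟩ : ∃ s, r = s + 1 := ⟨r - 1, by omega⟩
  rw [FRec_eq]
  congr 1
  omega
end

section
/- Let T and T' be unrooted binary phylogenetic trees on taxon sets X and X' respectively with |X| = |X'| = n ≥ 2. Then for every r ≥ 1, g_2(T, r) = g_2(T', r), and consequently g_2(T) = g_2(T'); that is, the number of convex characters in which each state appears on at least two taxa is independent of tree topology. -/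
open SimpleGraph

/-- Vertices lying on every walk between `a` and `b`. -/
def sg {V : Type} (G : SimpleGraph V) (a b : V) : Set V :=
  {w | ∀ p : G.Walk a b, w ∈ p.support}

section Graph
variable {V : Type} {G : SimpleGraph V}

lemma sg_left (a b : V) : a ∈ sg G a b := fun p => p.start_mem_support
lemma sg_right (a b : V) : b ∈ sg G a b := fun p => p.end_mem_support

lemma sg_symm (a b : V) : sg G a b = sg G b a := by
  ext w
  constructor
  · intro h p
    have := h p.reverse
    simpa using this
  · intro h p
    have := h p.reverse
    simpa using this

lemma sg_self (a : V) : sg G a a = {a} := by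
  ext w
  constructor
  · intro h
    have := h Walk.nil
    simpa using this
  · rintro rfl
    exact sg_left _ _

lemma sg_tri (a b c : V) : sg G a c ⊆ sg G a b ∪ sg G b c := by
  intro w hw
  by_contra hcon
  simp only [Set.mem_union, not_or] at hcon
  obtain ⟨h1, h2⟩ := hcon
  simp only [sg, Set.mem_ofPred_eq, not_forall] at h1 h2
  obtain ⟨p, hp⟩ := h1
  obtain ⟨q, hq⟩ := h2
  have := hw (p.append q)
  rw [Walk.mem_support_append_iff] at this
  tauto

lemma sg_sub {a v b : V} (hv : v ∈ sg G a b) : sg G a v ⊆ sg G a b := by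
  classical
  intro w hw p
  have h1 := hv p
  exact p.support_takeUntil_subset_support h1 (hw (p.takeUntil v h1))

lemma sg_inter (hG : G.Connected) {a b v w : V} (hw : w ∈ sg G a b) (h1 : v ∈ sg G a w)
    (h2 : v ∈ sg G w b) : v = w := by
  classical
  obtain ⟨p, hp⟩ := (hG.preconnected a b).exists_isPath
  have hwp := hw p
  have e := p.take_spec hwp
  have n := hp.support_nodup
  rw [← e, Walk.support_append] at n
  have h3 := h1 (p.takeUntil w hwp)
  have h4 := h2 (p.dropUntil w hwp)
  rw [Walk.mem_support_iff] at h4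
  rcases h4 with h4 | h4
  · exact h4
  · exact absurd h4 (fun h4 => (List.disjoint_of_nodup_append n) h3 h4)

lemma sg_anti (hG : G.Connected) {a v w : V} (h1 : w ∈ sg G a v) (h2 : v ∈ sg G a w) : v = w :=
  sg_inter hG h1 h2 (sg_right _ _)

lemma sg_eq_path (hT : G.IsTree) {a b : V} (p : G.Walk a b) (hp : p.IsPath) :
    sg G a b = {w | w ∈ p.support} := by
  classical
  ext w
  constructor
  · intro h
    exact h p
  · intro h q
    have : q.bypass = p := (hT.existsUnique_path a b).unique q.bypass_isPath hp
    apply q.support_bypass_subset_support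
    rw [this]; exact h

lemma sg_connected (hT : G.IsTree) (a b : V) : (G.induce (sg G a b)).Connected := by
  obtain ⟨p, hp⟩ := (hT.connected.preconnected a b).exists_isPath
  rw [sg_eq_path hT p hp]
  exact p.connected_induce_support

lemma sg_next (hT : G.IsTree) {a b : V} (hab : a ≠ b) : ∃ c, G.Adj a c ∧ c ∈ sg G a b := by
  obtain ⟨p, hp⟩ := (hT.connected.preconnected a b).exists_isPath
  rw [sg_eq_path hT p hp]
  cases p with
  | nil => exact absurd rfl hab
  | cons h q => exact ⟨_, h, by simp⟩

/-- descendants are convex -/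
lemma desc_convex (hG : G.Connected) {ρ v w x : V} (hx : v ∈ sg G ρ x) (hw : w ∈ sg G v x) :
    v ∈ sg G ρ w := by
  rcases sg_tri ρ w x hx with h | h
  · exact h
  · have : w = v := by
      rw [sg_symm] at h hw
      exact sg_anti hG h hw
    rw [this]; exact sg_right _ _

lemma ndesc_convex (hG : G.Connected) {ρ v w a b : V} (ha : v ∉ sg G ρ a) (hb : v ∉ sg G ρ b)
    (hw : w ∈ sg G a b) : v ∉ sg G ρ w := by
  intro h
  have h1 : v ∈ sg G a w := (sg_tri ρ a w h).resolve_left ha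
  have h2 : v ∈ sg G b w := (sg_tri ρ b w h).resolve_left hb
  rw [sg_symm] at h2
  have := sg_inter hG hw h1 h2
  subst this
  rcases sg_tri a ρ b hw with h | h
  · rw [sg_symm] at h; exact ha h
  · exact hb h

lemma exists_cherry_vertex [Finite V] (hT : G.IsTree) (hdeg : ∀ v, (G.neighborSet v).ncard ≤ 3)
    (S : Set V) (hS : ∀ v ∈ S, (G.neighborSet v).ncard = 1) (ρ : V) (hρ : ρ ∈ S)
    (h2 : 2 ≤ (S \ {ρ}).ncard) :
    ∃ v x y, x ≠ y ∧ x ∈ S \ {ρ} ∧ y ∈ S \ {ρ} ∧ 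
      ∀ z ∈ S \ {ρ}, (v ∈ sg G ρ z ↔ z = x ∨ z = y) ∧ v ∈ sg G ρ x ∧ v ∉ sg G ρ ρ := by
  classical
  have hG := hT.connected
  set Q : V → Set V := fun v => {z | z ∈ S \ {ρ} ∧ v ∈ sg G ρ z} with hQ
  have hex : ∃ v ∈ {v | 2 ≤ (Q v).ncard}, ∀ v' ∈ {v | 2 ≤ (Q v).ncard},
      {w | v ∈ sg G ρ w}.ncard ≤ {w | v' ∈ sg G ρ w}.ncard := by
    apply Set.exists_min_image _ _ (Set.toFinite _)
    refine ⟨ρ, ?_⟩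
    have : Q ρ = S \ {ρ} := by
      ext z; simp [hQ, sg_left]
    simpa [this] using h2
  obtain ⟨v, hv, hmin⟩ := hex
  simp only [Set.mem_ofPred_eq] at hv hmin
  -- no child of v has two descendants
  have key : ∀ c x y, x ≠ y → x ∈ Q v → y ∈ Q v → c ≠ v → c ∈ sg G v x → c ∈ sg G v y → False := by
    intro c x y hxy hx hy hcv hcx hcy
    have hvc : v ∈ sg G ρ c := desc_convex hG hx.2 hcx
    have up : ∀ x ∈ Q v, c ∈ sg G v x → c ∈ sg G ρ x := by
      intro x hx hc
      have h1 : v ∈ sg G x ρ := by rw [sg_symm]; exact hx.2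
      rw [sg_symm]
      apply sg_sub h1
      rw [sg_symm]; exact hc
    have h2c : 2 ≤ (Q c).ncard := by
      have : ({x, y} : Set V) ⊆ Q c := by
        rintro z (rfl | rfl)
        · exact ⟨hx.1, up _ hx hcx⟩
        · exact ⟨hy.1, up _ hy hcy⟩
      calc 2 = ({x, y} : Set V).ncard := (Set.ncard_pair hxy).symm
        _ ≤ _ := Set.ncard_le_ncard this (Set.toFinite _)
    have h3 := hmin c h2c
    have h4 : {w | c ∈ sg G ρ w} ⊂ {w | v ∈ sg G ρ w} := by
      refine ⟨fun w hw => sg_sub hw hvc, fun hsub => ?_⟩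
      have : v ∈ {w | c ∈ sg G ρ w} := hsub (sg_right _ _)
      exact hcv (sg_anti hG hvc this)
    have := Set.ncard_lt_ncard h4 (Set.toFinite _)
    omega
  have hnext : ∀ x, ∃ c, x ≠ v → G.Adj v c ∧ c ∈ sg G v x := by
    intro x
    by_cases hx : x = v
    · exact ⟨v, fun h => absurd hx h⟩
    · obtain ⟨c, hc⟩ := sg_next hT (Ne.symm hx)
      exact ⟨c, fun _ => hc⟩
  choose c hc using hnext
  have hpar : v ≠ ρ → ∃ p, G.Adj v p ∧ ∀ x ∈ Q v, x ≠ v → c x ≠ p := by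
    intro hne
    obtain ⟨p, hp1, hp2⟩ := sg_next hT hne
    refine ⟨p, hp1, ?_⟩
    rintro x hx hxv rfl
    rw [sg_symm] at hp2
    have := sg_inter hG hx.2 hp2 (hc x hxv).2
    exact (hp1.ne this.symm)
  have hinj : ∀ x ∈ Q v, x ≠ v → ∀ y ∈ Q v, y ≠ v → c x = c y → x = y := by
    intro x hx hxv y hy hyv hxy
    by_contra hne
    refine key (c x) x y hne hx hy (hc x hxv).1.ne' (hc x hxv).2 ?_
    rw [hxy]; exact (hc y hyv).2
  -- v is not the root
  obtain ⟨x, hx, y, hy, hxy⟩ := (Set.one_lt_ncard (Set.toFinite _)).1 (show 1 < (Q v).ncard by omega)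
  have hvρ : v ≠ ρ := by
    rintro rfl
    have h1 := hS v hρ
    obtain ⟨d, hd⟩ := Set.ncard_eq_one.1 h1
    have e1 : c x ∈ G.neighborSet v := (hc x hx.1.2).1
    have e2 : c y ∈ G.neighborSet v := (hc y hy.1.2).1
    rw [hd] at e1 e2
    exact hxy (hinj x hx hx.1.2 y hy hy.1.2 (by rw [e1, e2]))
  obtain ⟨p, hp1, hp2⟩ := hpar hvρ
  have hvS : v ∉ S := by
    intro hvS
    obtain ⟨d, hd⟩ := Set.ncard_eq_one.1 (hS v hvS)
    have e1 : p ∈ G.neighborSet v := hp1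
    have aux : ∀ x ∈ Q v, x ≠ v → False := by
      intro x hx hxv
      have e2 : c x ∈ G.neighborSet v := (hc x hxv).1
      rw [hd] at e1 e2
      exact hp2 x hx hxv (by rw [e1, e2])
    by_cases h : x = v
    · exact aux y hy (by rw [← h]; exact hxy.symm)
    · exact aux x hx h
  have hQv : ∀ x ∈ Q v, x ≠ v := by
    rintro x hx rfl
    exact hvS hx.1.1
  have hle : (Q v).ncard ≤ 2 := by
    have h1 : (Q v).ncard ≤ (G.neighborSet v \ {p}).ncard := by
      apply Set.ncard_le_ncard_of_injOn c
      · intro x hx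
        exact ⟨(hc x (hQv x hx)).1, hp2 x hx (hQv x hx)⟩
      · intro x hx y hy
        exact hinj x hx (hQv x hx) y hy (hQv y hy)
    have h3 : (G.neighborSet v \ {p}).ncard + 1 = (G.neighborSet v).ncard :=
      Set.ncard_sdiff_singleton_add_one hp1 (Set.toFinite _)
    have := hdeg v
    omega
  refine ⟨v, x, y, hxy, hx.1, hy.1, fun z hz => ⟨⟨fun hvz => ?_, ?_⟩, hx.2, ?_⟩⟩
  · have : ({x, y} : Set V) = Q v := by
      apply Set.eq_of_subset_of_ncard_le
      · rintro z (rfl | rfl)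
        · exact hx
        · exact hy
      · rw [Set.ncard_pair hxy]; exact hle
      · exact Set.toFinite _
    have hz' : z ∈ Q v := ⟨hz, hvz⟩
    rw [← this] at hz'
    simpa using hz'
  · rintro (rfl | rfl)
    · exact hx.2
    · exact hy.2
  · rw [sg_self]; exact hvρ

lemma extend_conn [Finite V] {I : Type} (hG : G.Connected) : ∀ (k : ℕ) (U : Set V) (h : V → I)
    (P : Set I), Uᶜ.ncard = k → U.Nonempty → (∀ v ∈ U, h v ∈ P) →
    (∀ i ∈ P, (G.induce {v | v ∈ U ∧ h v = i}).Connected) →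
    ∃ h' : V → I, (∀ v ∈ U, h' v = h v) ∧ (∀ v, h' v ∈ P) ∧
      ∀ i ∈ P, (G.induce {v | h' v = i}).Connected := by
  classical
  intro k
  induction k with
  | zero =>
    intro U h P hk _ hP hc
    have hU : ∀ v, v ∈ U := by
      intro v
      have := (Set.ncard_eq_zero (Set.toFinite _)).1 hk
      rw [Set.compl_empty_iff] at this
      rw [this]; trivial
    refine ⟨h, fun _ _ => rfl, fun v => hP v (hU v), ?_⟩
    intro i hi
    have := hc i hi
    have e : {v | v ∈ U ∧ h v = i} = {v | h v = i} := by ext v; simp [hU]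
    rwa [e] at this
  | succ k ih =>
    intro U h P hk hne hP hc
    obtain ⟨u0, hu0⟩ := hne
    have : ∃ w0, w0 ∉ U := by
      by_contra hcon
      push Not at hcon
      have : Uᶜ = ∅ := by rw [Set.compl_empty_iff]; ext; simp [hcon]
      rw [this] at hk; simp at hk
    obtain ⟨w0, hw0⟩ := this
    obtain ⟨p⟩ := hG.preconnected u0 w0
    obtain ⟨d, -, hd1, hd2⟩ := p.exists_boundary_dart U hu0 hw0
    set u := d.fst
    set w := d.snd
    have huw : G.Adj u w := d.adj
    have hne' : ∀ v ∈ U, v ≠ w := by rintro v hv rfl; exact hd2 hv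
    obtain ⟨h', h1, h2, h3⟩ := ih (insert w U) (Function.update h w (h u)) P
      (by
        have : (insert w U)ᶜ = Uᶜ \ {w} := by ext; simp; tauto
        rw [this]
        have := Set.ncard_sdiff_singleton_add_one (s := Uᶜ) (a := w) hd2 (Set.toFinite _)
        omega)
      ⟨w, by simp⟩
      (by
        rintro v (rfl | hv)
        · simpa using hP u hd1
        · rw [Function.update_of_ne (hne' v hv)]; exact hP v hv)
      (by
        intro i hi
        by_cases hiu : h u = i
        · have : {v | v ∈ insert w U ∧ Function.update h w (h u) v = i}
              = {v | v ∈ U ∧ h v = i} ∪ {u, w} := by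
            ext v
            by_cases hvw : v = w
            · subst hvw; simp [hiu]
            · simp only [Set.mem_insert_iff, hvw, false_or, Set.mem_ofPred_eq, Set.mem_union,
                Set.mem_singleton_iff, or_false, Function.update_of_ne hvw]
              constructor
              · exact fun h => Or.inl h
              · rintro (h | rfl)
                · exact h
                · exact ⟨hd1, hiu⟩
          rw [this]
          exact induce_union_connected (hc i hi).preconnected
            (induce_pair_connected_of_adj huw).preconnected ⟨u, ⟨hd1, hiu⟩, by simp⟩
        · have : {v | v ∈ insert w U ∧ Function.update h w (h u) v = i}
              = {v | v ∈ U ∧ h v = i} := by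
            ext v
            by_cases hvw : v = w
            · subst hvw; simp [hiu, hd2]
            · simp [hvw]
          rw [this]; exact hc i hi)
    refine ⟨h', ?_, h2, h3⟩
    intro v hv
    rw [h1 v (Set.mem_insert_of_mem _ hv), Function.update_of_ne (hne' v hv)]

end Graph

/-- Partitions of `S` into blocks of size at least two with pairwise disjoint spans. -/
structure Good {V X : Type} (s : X → X → Set V) (S : Finset X) (P : Finset (Finset X)) : Prop where
  size : ∀ C ∈ P, 2 ≤ C.card
  sub : ∀ C ∈ P, C ⊆ S
  cov : ∀ a ∈ S, ∃ C ∈ P, a ∈ C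
  disj : ∀ C ∈ P, ∀ C' ∈ P, C ≠ C' → ∀ a ∈ C, ∀ b ∈ C, ∀ c ∈ C', ∀ d ∈ C',
    Disjoint (s a b) (s c d)

/-- The good partitions with `r` blocks. -/
def goodSet {V X : Type} (s : X → X → Set V) (S : Finset X) (r : ℕ) : Set (Finset (Finset X)) :=
  {P | Good s S P ∧ P.card = r}

/-- `x, y` form a cherry of `S`. -/
structure Cherry {V X : Type} (s : X → X → Set V) (S : Finset X) (x y : X) : Prop where
  hx : x ∈ S
  hy : y ∈ S
  ne : x ≠ y
  c1 : ∀ a ∈ S, a ≠ x → a ≠ y → ∀ b ∈ S, b ≠ x → b ≠ y → Disjoint (s x y) (s a b)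
  c2 : ∀ a ∈ S, a ≠ x → a ≠ y → ∀ b ∈ S, b ≠ x → b ≠ y → ¬ Disjoint (s x a) (s y b)
  c3 : ∀ a ∈ S, a ≠ x → a ≠ y → ∀ b ∈ S, b ≠ x → b ≠ y → ∀ c ∈ S, c ≠ x → c ≠ y →
    Disjoint (s x a) (s b c) → Disjoint (s y a) (s b c)

section Count
variable {V X : Type} {s : X → X → Set V}

lemma Good.eq_of_mem (hne : ∀ a, (s a a).Nonempty) {S : Finset X} {P : Finset (Finset X)}
    (h : Good s S P) {C C' : Finset X} (hC : C ∈ P) (hC' : C' ∈ P) {a : X} (h1 : a ∈ C)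
    (h2 : a ∈ C') : C = C' := by
  by_contra hcon
  have := h.disj C hC C' hC' hcon a h1 a h1 a h2 a h2
  rw [disjoint_self] at this
  exact (hne a).ne_empty this

variable [DecidableEq X]

/-- Add `y` to the block containing `x`. -/
def addTo (x y : X) (C : Finset X) : Finset X := if x ∈ C then insert y C else C

lemma goodSet_zero_of_nonempty {S : Finset X} (hS : S.Nonempty) : goodSet s S 0 = ∅ := by
  ext P
  simp only [goodSet, Set.mem_ofPred_eq, Set.mem_empty_iff_false, iff_false, not_and]
  intro h h0
  rw [Finset.card_eq_zero] at h0
  subst h0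
  obtain ⟨a, ha⟩ := hS
  obtain ⟨C, hC, -⟩ := h.cov a ha
  simp at hC

lemma good_insert (hsym : ∀ a b, s a b = s b a)
    (hss : ∀ a b, s a a ⊆ s a b) {S : Finset X} {x y : X} (hc : Cherry s S x y)
    {Q : Finset (Finset X)} (hQ : Good s ((S.erase y).erase x) Q) :
    Good s S (insert {x, y} Q) := by
  have hQm : ∀ C ∈ Q, ∀ a ∈ C, a ∈ S ∧ a ≠ x ∧ a ≠ y := by
    intro C hC a ha
    have := hQ.sub C hC ha
    simp at this; tauto
  have base : ∀ a ∈ ({x, y} : Finset X), ∀ b ∈ ({x, y} : Finset X), s a b ⊆ s x y := by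
    intro a ha b hb
    simp only [Finset.mem_insert, Finset.mem_singleton] at ha hb
    rcases ha with rfl | rfl <;> rcases hb with rfl | rfl
    · exact hss _ _
    · exact subset_rfl
    · rw [hsym]
    · rw [hsym x]; exact hss _ _
  have bd : ∀ a ∈ ({x, y} : Finset X), ∀ b ∈ ({x, y} : Finset X), ∀ C ∈ Q, ∀ c ∈ C, ∀ d ∈ C,
      Disjoint (s a b) (s c d) := by
    intro a ha b hb C hC c hcC d hdC
    obtain ⟨u1, u2, u3⟩ := hQm C hC c hcC
    obtain ⟨v1, v2, v3⟩ := hQm C hC d hdC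
    exact (hc.c1 c u1 u2 u3 d v1 v2 v3).mono_left (base a ha b hb)
  refine ⟨?_, ?_, ?_, ?_⟩
  · intro C hC
    rcases Finset.mem_insert.1 hC with rfl | hC
    · rw [Finset.card_pair hc.ne]
    · exact hQ.size C hC
  · intro C hC
    rcases Finset.mem_insert.1 hC with rfl | hC
    · intro a ha
      simp only [Finset.mem_insert, Finset.mem_singleton] at ha
      rcases ha with rfl | rfl
      · exact hc.hx
      · exact hc.hy
    · intro a ha; exact (hQm C hC a ha).1
  · intro a ha
    by_cases h1 : a = x
    · exact ⟨{x, y}, by simp, by simp [h1]⟩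
    by_cases h2 : a = y
    · exact ⟨{x, y}, by simp, by simp [h2]⟩
    obtain ⟨C, hC, haC⟩ := hQ.cov a (by simp [h1, h2, ha])
    exact ⟨C, by simp [hC], haC⟩
  · intro C hC C' hC' hCC a ha b hb c hcC d hd
    rcases Finset.mem_insert.1 hC with rfl | hC <;> rcases Finset.mem_insert.1 hC' with rfl | hC'
    · exact absurd rfl hCC
    · exact bd a ha b hb C' hC' c hcC d hd
    · exact (bd c hcC d hd C hC a ha b hb).symm
    · exact hQ.disj C hC C' hC' hCC a ha b hb c hcC d hd

lemma good_erase (hne : ∀ a, (s a a).Nonempty) {S : Finset X} {x y : X} (hc : Cherry s S x y)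
    {P : Finset (Finset X)} (hP : Good s S P) (hxy : {x, y} ∈ P) :
    Good s ((S.erase y).erase x) (P.erase {x, y}) := by
  refine ⟨?_, ?_, ?_, ?_⟩
  · intro C hC
    exact hP.size C (Finset.mem_of_mem_erase hC)
  · intro C hC a ha
    obtain ⟨h1, h2⟩ := Finset.mem_erase.1 hC
    simp only [Finset.mem_erase]
    refine ⟨?_, ?_, hP.sub C h2 ha⟩
    · rintro rfl
      exact h1 (hP.eq_of_mem hne h2 hxy ha (by simp))
    · rintro rfl
      exact h1 (hP.eq_of_mem hne h2 hxy ha (by simp))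
  · intro a ha
    simp only [Finset.mem_erase] at ha
    obtain ⟨C, hC, haC⟩ := hP.cov a ha.2.2
    refine ⟨C, ?_, haC⟩
    rw [Finset.mem_erase]
    refine ⟨?_, hC⟩
    rintro rfl
    simp at haC; tauto
  · intro C hC C' hC' 
    exact hP.disj C (Finset.mem_of_mem_erase hC) C' (Finset.mem_of_mem_erase hC')

lemma good_addTo (hne : ∀ a, (s a a).Nonempty) (hsym : ∀ a b, s a b = s b a)
    (hss : ∀ a b, s a a ⊆ s a b) {S : Finset X} {x y : X} (hc : Cherry s S x y)
    {Q : Finset (Finset X)} (hQ : Good s (S.erase y) Q) :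
    Good s S (Q.image (addTo x y)) := by
  have hQm : ∀ C ∈ Q, ∀ a ∈ C, a ∈ S ∧ a ≠ y := by
    intro C hC a ha
    have := hQ.sub C hC ha
    simp at this; tauto
  -- main disjointness
  have key : ∀ C ∈ Q, x ∈ C → ∀ C' ∈ Q, C ≠ C' → ∀ a ∈ insert y C, ∀ b ∈ insert y C,
      ∀ c ∈ C', ∀ d ∈ C', Disjoint (s a b) (s c d) := by
    intro C hC hxC C' hC' hCC
    have hm' : ∀ c ∈ C', c ∈ S ∧ c ≠ x ∧ c ≠ y := by
      intro c hcC
      refine ⟨(hQm C' hC' c hcC).1, ?_, (hQm C' hC' c hcC).2⟩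
      rintro rfl
      exact hCC (hQ.eq_of_mem hne hC hC' hxC hcC)
    have hyb : ∀ b ∈ insert y C, ∀ c ∈ C', ∀ d ∈ C', Disjoint (s y b) (s c d) := by
      intro b hb c hcC d hdC
      obtain ⟨u1, u2, u3⟩ := hm' c hcC
      obtain ⟨v1, v2, v3⟩ := hm' d hdC
      have h0 := hc.c1 c u1 u2 u3 d v1 v2 v3
      rw [hsym] at h0
      by_cases hby : b = y
      · subst hby
        exact h0.mono_left (hss _ _)
      by_cases hbx : b = x
      · subst hbx
        exact h0
      have hbC : b ∈ C := by simpa [hby] using hb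
      exact hc.c3 b (hQm C hC b hbC).1 hbx hby c u1 u2 u3 d v1 v2 v3
        (hQ.disj C hC C' hC' hCC x hxC b hbC c hcC d hdC)
    intro a ha b hb c hcC d hdC
    by_cases hay : a = y
    · subst hay; exact hyb b hb c hcC d hdC
    by_cases hby : b = y
    · subst hby; rw [hsym]; exact hyb a ha c hcC d hdC
    have haC : a ∈ C := by simpa [hay] using ha
    have hbC : b ∈ C := by simpa [hby] using hb
    exact hQ.disj C hC C' hC' hCC a haC b hbC c hcC d hdC
  refine ⟨?_, ?_, ?_, ?_⟩
  · intro C hC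
    obtain ⟨D, hD, rfl⟩ := Finset.mem_image.1 hC
    have h1 := hQ.size D hD
    unfold addTo
    split_ifs
    · exact h1.trans (Finset.card_le_card (Finset.subset_insert _ _))
    · exact h1
  · intro C hC a ha
    obtain ⟨D, hD, rfl⟩ := Finset.mem_image.1 hC
    unfold addTo at ha
    split_ifs at ha
    · rcases Finset.mem_insert.1 ha with rfl | ha
      · exact hc.hy
      · exact (hQm D hD a ha).1
    · exact (hQm D hD a ha).1
  · intro a ha
    by_cases h2 : a = y
    · obtain ⟨C, hC, haC⟩ := hQ.cov x (by simp [hc.ne, hc.hx])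
      exact ⟨addTo x y C, Finset.mem_image_of_mem _ hC, by simp [addTo, haC, h2]⟩
    obtain ⟨C, hC, haC⟩ := hQ.cov a (by simp [h2, ha])
    refine ⟨addTo x y C, Finset.mem_image_of_mem _ hC, ?_⟩
    unfold addTo
    split_ifs
    · exact Finset.mem_insert_of_mem haC
    · exact haC
  · intro C hC C' hC' hCC a ha b hb c hcC d hd
    obtain ⟨D, hD, rfl⟩ := Finset.mem_image.1 hC
    obtain ⟨D', hD', rfl⟩ := Finset.mem_image.1 hC'
    have hDD : D ≠ D' := by rintro rfl; exact hCC rfl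
    unfold addTo at ha hb hcC hd
    by_cases h1 : x ∈ D <;> by_cases h2 : x ∈ D'
    · exact absurd (hQ.eq_of_mem hne hD hD' h1 h2) hDD
    · simp only [h1, h2, if_true, if_false] at ha hb hcC hd
      exact key D hD h1 D' hD' hDD a ha b hb c hcC d hd
    · simp only [h1, h2, if_true, if_false] at ha hb hcC hd
      exact (key D' hD' h2 D hD hDD.symm c hcC d hd a ha b hb).symm
    · simp only [h1, h2, if_false] at ha hb hcC hd
      exact hQ.disj D hD D' hD' hDD a ha b hb c hcC d hd

lemma same_block (hne : ∀ a, (s a a).Nonempty) {S : Finset X} {x y : X} (hc : Cherry s S x y)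
    {P : Finset (Finset X)} (hP : Good s S P) {C : Finset X} (hC : C ∈ P) :
    x ∈ C ↔ y ∈ C := by
  have main : ∀ C ∈ P, x ∈ C → y ∈ C := by
    intro C hC hxC
    by_contra hyC
    obtain ⟨C', hC', hyC'⟩ := hP.cov y hc.hy
    have hCC : C ≠ C' := by rintro rfl; exact hyC hyC'
    obtain ⟨a, ha, hax⟩ := Finset.exists_mem_ne (hP.size C hC) x
    obtain ⟨b, hb, hby⟩ := Finset.exists_mem_ne (hP.size C' hC') y
    have h1 : a ≠ y := by rintro rfl; exact hyC ha
    by_cases hbx : b = x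
    · subst hbx
      exact hCC (hP.eq_of_mem hne hC hC' hxC hb)
    · exact hc.c2 a (hP.sub C hC ha) hax h1 b (hP.sub C' hC' hb) hbx hby
        (hP.disj C hC C' hC' hCC x hxC a ha y hyC' b hb)
  refine ⟨main C hC, fun hy => ?_⟩
  obtain ⟨C', hC', hxC'⟩ := hP.cov x hc.hx
  have := hP.eq_of_mem hne hC hC' hy (main C' hC' hxC')
  rw [this]; exact hxC'

lemma addTo_erase (hne : ∀ a, (s a a).Nonempty) {S : Finset X} {x y : X} (hc : Cherry s S x y)
    {P : Finset (Finset X)} (hP : Good s S P) {C : Finset X} (hC : C ∈ P) :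
    addTo x y (C.erase y) = C := by
  have := same_block hne hc hP hC
  have hxy := hc.ne
  unfold addTo
  by_cases hx : x ∈ C
  · rw [if_pos (by simp [hx, hxy]), Finset.insert_erase (this.1 hx)]
  · rw [if_neg (by simp [hx]), Finset.erase_eq_of_notMem (by rwa [← this])]

lemma erase_addTo {x y : X} {C : Finset X} (hy : y ∉ C) : (addTo x y C).erase y = C := by
  unfold addTo
  split_ifs
  · rw [Finset.erase_insert hy]
  · exact Finset.erase_eq_of_notMem hy

lemma good_remove (hne : ∀ a, (s a a).Nonempty) {S : Finset X} {x y : X} (hc : Cherry s S x y)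
    {P : Finset (Finset X)} (hP : Good s S P) (hxy : {x, y} ∉ P) :
    Good s (S.erase y) (P.image (fun C => C.erase y)) := by
  refine ⟨?_, ?_, ?_, ?_⟩
  · intro C hC
    obtain ⟨D, hD, rfl⟩ := Finset.mem_image.1 hC
    by_cases hy : y ∈ D
    · have hx := (same_block hne hc hP hD).2 hy
      have h1 : ({x, y} : Finset X) ⊂ D := by
        rw [Finset.ssubset_iff_subset_ne]
        refine ⟨?_, ?_⟩
        · intro a ha
          simp only [Finset.mem_insert, Finset.mem_singleton] at ha
          rcases ha with rfl | rfl <;> assumption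
        · rintro rfl; exact hxy hD
      have h2 := Finset.card_lt_card h1
      rw [Finset.card_pair hc.ne] at h2
      rw [Finset.card_erase_of_mem hy]
      omega
    · rw [Finset.erase_eq_of_notMem hy]; exact hP.size D hD
  · intro C hC
    obtain ⟨D, hD, rfl⟩ := Finset.mem_image.1 hC
    exact Finset.erase_subset_erase _ (hP.sub D hD)
  · intro a ha
    obtain ⟨h1, h2⟩ := Finset.mem_erase.1 ha
    obtain ⟨C, hC, haC⟩ := hP.cov a h2
    exact ⟨C.erase y, Finset.mem_image_of_mem _ hC, Finset.mem_erase.2 ⟨h1, haC⟩⟩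
  · intro C hC C' hC' hCC a ha b hb c hcC d hd
    obtain ⟨D, hD, rfl⟩ := Finset.mem_image.1 hC
    obtain ⟨D', hD', rfl⟩ := Finset.mem_image.1 hC'
    exact hP.disj D hD D' hD' (by rintro rfl; exact hCC rfl) a (Finset.mem_of_mem_erase ha)
      b (Finset.mem_of_mem_erase hb) c (Finset.mem_of_mem_erase hcC) d (Finset.mem_of_mem_erase hd)

lemma goodSet_rec [Finite X] (hne : ∀ a, (s a a).Nonempty) (hsym : ∀ a b, s a b = s b a)
    (hss : ∀ a b, s a a ⊆ s a b) {S : Finset X} {x y : X} (hc : Cherry s S x y) (r : ℕ) :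
    (goodSet s S (r + 1)).ncard = (goodSet s (S.erase y) (r + 1)).ncard
      + (goodSet s ((S.erase y).erase x) r).ncard := by
  have notin : ∀ Q, Good s ((S.erase y).erase x) Q → {x, y} ∉ Q := by
    intro Q hQ h
    have := hQ.sub _ h (Finset.mem_insert_self x {y})
    simp at this
  have yn : ∀ Q, Good s (S.erase y) Q → ∀ C ∈ Q, y ∉ C := by
    intro Q hQ C hC h
    have := hQ.sub _ hC h
    simp at this
  have back : ∀ Q, Good s (S.erase y) Q →
      (Q.image (addTo x y)).image (fun C => C.erase y) = Q := by
    intro Q hQ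
    rw [Finset.image_image]
    conv_rhs => rw [← Finset.image_id (s := Q)]
    apply Finset.image_congr
    intro C hC
    exact erase_addTo (yn Q hQ C hC)
  have forw : ∀ P, Good s S P →
      (P.image (fun C => C.erase y)).image (addTo x y) = P := by
    intro P hP
    rw [Finset.image_image]
    conv_rhs => rw [← Finset.image_id (s := P)]
    apply Finset.image_congr
    intro C hC
    exact addTo_erase hne hc hP hC
  have e : goodSet s S (r + 1) =
      (fun Q : Finset (Finset X) => Q.image (addTo x y)) '' goodSet s (S.erase y) (r + 1)
      ∪ (fun Q => insert {x, y} Q) '' goodSet s ((S.erase y).erase x) r := by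
    ext P
    constructor
    · rintro ⟨hP, hr⟩
      by_cases h : {x, y} ∈ P
      · right
        refine ⟨P.erase {x, y}, ⟨good_erase hne hc hP h, ?_⟩, Finset.insert_erase h⟩
        rw [Finset.card_erase_of_mem h, hr]; rfl
      · left
        refine ⟨_, ⟨good_remove hne hc hP h, ?_⟩, forw P hP⟩
        rw [Finset.card_image_of_injOn, hr]
        intro C hC C' hC' hCC
        rw [← addTo_erase hne hc hP hC, ← addTo_erase hne hc hP hC']
        exact congrArg _ hCC
    · rintro (⟨Q, ⟨hQ, hr⟩, rfl⟩ | ⟨Q, ⟨hQ, hr⟩, rfl⟩)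
      · refine ⟨good_addTo hne hsym hss hc hQ, ?_⟩
        rw [Finset.card_image_of_injOn, hr]
        intro C hC C' hC' hCC
        rw [← erase_addTo (x := x) (yn Q hQ C hC), ← erase_addTo (x := x) (yn Q hQ C' hC'), hCC]
      · refine ⟨good_insert hsym hss hc hQ, ?_⟩
        rw [Finset.card_insert_of_notMem (notin Q hQ), hr]
  rw [e, Set.ncard_union_eq, Set.ncard_image_of_injOn, Set.ncard_image_of_injOn]
  · intro Q hQ Q' hQ' h
    simp only at h
    rw [← Finset.erase_insert (notin Q hQ.1), h, Finset.erase_insert (notin Q' hQ'.1)]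
  · intro Q hQ Q' hQ' h
    simp only at h
    rw [← back Q hQ.1, h, back Q' hQ'.1]
  · rw [Set.disjoint_left]
    rintro P ⟨Q, hQ, rfl⟩ ⟨Q', hQ', h⟩
    have h1 : ({x, y} : Finset X) ∈ Q.image (addTo x y) := by
      simp only at h
      rw [← h]; simp
    obtain ⟨C, hC, hCe⟩ := Finset.mem_image.1 h1
    have h2 : C = {x} := by
      rw [← erase_addTo (x := x) (yn Q hQ.1 C hC), hCe]
      ext a
      simp only [Finset.mem_erase, Finset.mem_insert, Finset.mem_singleton]
      have := hc.ne
      constructor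
      · tauto
      · rintro rfl; tauto
    have := hQ.1.size C hC
    rw [h2] at this
    simp at this

/-- The universal count. -/
def cnt : ℕ → ℕ → ℕ
  | 0, 0 => 1
  | 0, _ + 1 => 0
  | _ + 1, 0 => 0
  | 1, _ + 1 => 0
  | n + 2, r + 1 => cnt (n + 1) (r + 1) + cnt n r

lemma goodSet_ncard [Finite X] (hne : ∀ a, (s a a).Nonempty) (hsym : ∀ a b, s a b = s b a)
    (hss : ∀ a b, s a a ⊆ s a b)
    (hch : ∀ S : Finset X, 2 ≤ S.card → ∃ x y, Cherry s S x y) :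
    ∀ (n r : ℕ) (S : Finset X), S.card = n → (goodSet s S r).ncard = cnt n r := by
  intro n r
  induction n, r using cnt.induct with
  | case1 =>
    intro S hS
    rw [Finset.card_eq_zero] at hS
    subst hS
    have : goodSet s ∅ 0 = {∅} := by
      ext P
      constructor
      · rintro ⟨_, h⟩
        simpa using h
      · rintro rfl
        exact ⟨⟨by simp, by simp, by simp, by simp⟩, rfl⟩
    rw [this]; simp [cnt]
  | case2 r =>
    intro S hS
    rw [Finset.card_eq_zero] at hS
    subst hS
    have : goodSet s ∅ (r + 1) = ∅ := by
      ext P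
      simp only [Set.mem_empty_iff_false, iff_false]
      rintro ⟨h, h0⟩
      obtain ⟨C, hC⟩ := Finset.card_pos.1 (show 0 < P.card by omega)
      have h1 := h.size C hC
      have h2 := Finset.card_le_card (h.sub C hC)
      simp at h2; simp [h2] at h1
    rw [this]; simp [cnt]
  | case3 n =>
    intro S hS
    rw [goodSet_zero_of_nonempty (Finset.card_pos.1 (by omega))]
    simp [cnt]
  | case4 r =>
    intro S hS
    have : goodSet s S (r + 1) = ∅ := by
      ext P
      simp only [Set.mem_empty_iff_false, iff_false]
      rintro ⟨h, h0⟩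
      obtain ⟨C, hC⟩ := Finset.card_pos.1 (show 0 < P.card by omega)
      have h1 := h.size C hC
      have h2 := Finset.card_le_card (h.sub C hC)
      omega
    rw [this]; simp [cnt]
  | case5 n r ih1 ih2 =>
    intro S hS
    obtain ⟨x, y, hc⟩ := hch S (by omega)
    have h1 : (S.erase y).card = n + 1 := by rw [Finset.card_erase_of_mem hc.hy]; omega
    have h2 : ((S.erase y).erase x).card = n := by
      rw [Finset.card_erase_of_mem (by simp [hc.hx, hc.ne])]; omega
    rw [goodSet_rec hne hsym hss hc, ih1 _ h1, ih2 _ h2, cnt]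

end Count

section Final
variable {V X : Type}

lemma tree_cherry [Finite V] [DecidableEq X] (T : UnrootedBinaryTree V X) (S : Finset X)
    (hS : 2 ≤ S.card) :
    ∃ x y, Cherry (fun a b => sg T.graph (T.label a) (T.label b)) S x y := by
  classical
  have hT := T.isTree
  have hG := hT.connected
  rcases Nat.lt_or_ge 2 S.card with h3 | h3
  · obtain ⟨ρ, hρ⟩ := Finset.card_pos.1 (show 0 < S.card by omega)
    obtain ⟨v, x', y', hxy, hx, hy, hv⟩ := exists_cherry_vertex hT
      (fun v => by
        have := T.degOneOrThree v
        unfold vdeg at this; omega)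
      (T.label '' (S : Set X)) (by rintro _ ⟨x, -, rfl⟩; exact T.label_leaf x) (T.label ρ)
      ⟨ρ, hρ, rfl⟩ (by
        have h1 := Set.ncard_sdiff_singleton_add_one (s := T.label '' (S : Set X))
          (a := T.label ρ) ⟨ρ, hρ, rfl⟩ (Set.toFinite _)
        rw [Set.ncard_image_of_injective _ T.label_inj, Set.ncard_coe_finset] at h1
        omega)
    obtain ⟨⟨x, hxS, rfl⟩, hxρ⟩ := hx
    obtain ⟨⟨y, hyS, rfl⟩, hyρ⟩ := hy
    have hvx : v ∈ sg T.graph (T.label ρ) (T.label x) := (hv _ ⟨⟨x, hxS, rfl⟩, hxρ⟩).2.1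
    have hvy : v ∈ sg T.graph (T.label ρ) (T.label y) :=
      (hv _ ⟨⟨y, hyS, rfl⟩, hyρ⟩).1.2 (Or.inr rfl)
    have hvρ := (hv _ ⟨⟨x, hxS, rfl⟩, hxρ⟩).2.2
    have hva : ∀ a ∈ S, a ≠ x → a ≠ y → v ∉ sg T.graph (T.label ρ) (T.label a) := by
      intro a ha hax hay
      by_cases h : T.label a = T.label ρ
      · rw [h]; exact hvρ
      · rw [(hv _ ⟨⟨a, ha, rfl⟩, h⟩).1]
        rintro (h | h)
        · exact hax (T.label_inj h)
        · exact hay (T.label_inj h)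
    set l := T.label
    set G := T.graph
    -- spans of non-descendants avoid the segment below v
    have dis : ∀ z, v ∈ sg G (l ρ) z → ∀ b ∈ S, b ≠ x → b ≠ y → ∀ c ∈ S, c ≠ x → c ≠ y →
        Disjoint (sg G v z) (sg G (l b) (l c)) := by
      intro z hz b hb hbx hby c hc hcx hcy
      rw [Set.disjoint_left]
      intro w hw hw'
      exact ndesc_convex hG (hva b hb hbx hby) (hva c hc hcx hcy) hw' (desc_convex hG hz hw)
    have thru : ∀ z, v ∈ sg G (l ρ) z → ∀ a ∈ S, a ≠ x → a ≠ y → v ∈ sg G z (l a) := by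
      intro z hz a ha hax hay
      have := (sg_tri (l ρ) (l a) z hz).resolve_left (hva a ha hax hay)
      rwa [sg_symm]
    refine ⟨x, y, hxS, hyS, fun h => hxy (by rw [h]), ?_, ?_, ?_⟩
    · intro a ha hax hay b hb hbx hby
      apply Disjoint.mono_left (sg_tri (l x) v (l y))
      rw [Set.disjoint_union_left]
      refine ⟨?_, dis _ hvy a ha hax hay b hb hbx hby⟩
      rw [sg_symm]
      exact dis _ hvx a ha hax hay b hb hbx hby
    · intro a ha hax hay b hb hbx hby hd
      exact Set.disjoint_left.1 hd (thru _ hvx a ha hax hay) (thru _ hvy b hb hbx hby)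
    · intro a ha hax hay b hb hbx hby c hc hcx hcy hd
      apply Disjoint.mono_left (sg_tri (l y) v (l a))
      rw [Set.disjoint_union_left]
      constructor
      · rw [sg_symm]; exact dis _ hvy b hb hbx hby c hc hcx hcy
      · apply Disjoint.mono_left _ hd
        have h1 := thru _ hvx a ha hax hay
        show sg G v (l a) ⊆ sg G (l x) (l a)
        rw [sg_symm v, sg_symm (l x)]
        rw [sg_symm] at h1
        exact sg_sub h1
  · obtain ⟨x, y, hxy, rfl⟩ := Finset.card_eq_two.1 (le_antisymm h3 hS)
    refine ⟨x, y, by simp, by simp, hxy, ?_, ?_, ?_⟩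
    · intro a ha; simp at ha; tauto
    · intro a ha; simp at ha; tauto
    · intro a ha; simp at ha; tauto

lemma good_iff [Finite V] [Fintype X] [Nonempty X] (T : UnrootedBinaryTree V X)
    (P : Finset (Finset X)) :
    Good (fun a b => sg T.graph (T.label a) (T.label b)) Finset.univ P ↔
      IsCharacter P ∧ IsConvexChar T P ∧ ∀ B ∈ P, 2 ≤ B.card := by
  classical
  have hT := T.isTree
  have hG := hT.connected
  constructor
  · intro h
    have hne : ∀ a, (sg T.graph (T.label a) (T.label a)).Nonempty := fun a => ⟨_, sg_left _ _⟩
    refine ⟨⟨?_, ?_, ?_⟩, ?_, h.size⟩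
    · intro B hB
      exact Finset.card_pos.1 (by have := h.size B hB; omega)
    · intro B hB B' hB' hBB
      rw [Finset.disjoint_left]
      intro a ha ha'
      exact hBB (h.eq_of_mem hne hB hB' ha ha')
    · intro x; exact h.cov x (Finset.mem_univ _)
    · set hull : Finset X → Set V := fun B =>
        {v | ∃ a ∈ B, ∃ b ∈ B, v ∈ sg T.graph (T.label a) (T.label b)} with hhull
      have hd : ∀ B ∈ P, ∀ B' ∈ P, ∀ v, v ∈ hull B → v ∈ hull B' → B = B' := by
        rintro B hB B' hB' v ⟨a, ha, b, hb, hv⟩ ⟨c, hc, d, hd, hv'⟩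
        by_contra hBB
        exact Set.disjoint_left.1 (h.disj B hB B' hB' hBB a ha b hb c hc d hd) hv hv'
      have hconn : ∀ B ∈ P, (T.graph.induce (hull B)).Connected := by
        intro B hB
        obtain ⟨a, ha⟩ := Finset.card_pos.1 (show 0 < B.card by have := h.size B hB; omega)
        apply induce_connected_of_patches (T.label a)
          (show T.label a ∈ hull B from ⟨a, ha, a, ha, sg_left _ _⟩)
        rintro v ⟨b, hb, c, hc, hv⟩
        have hsub : ∀ b ∈ B, sg T.graph (T.label a) (T.label b) ⊆ hull B :=
          fun b hb w hw => ⟨a, ha, b, hb, hw⟩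
        rcases sg_tri _ (T.label a) _ hv with hv | hv
        · rw [sg_symm] at hv
          exact ⟨_, hsub b hb, sg_left _ _, hv, (sg_connected hT _ _).preconnected _ _⟩
        · exact ⟨_, hsub c hc, sg_left _ _, hv, (sg_connected hT _ _).preconnected _ _⟩
      let U : Set V := {v | ∃ B ∈ P, v ∈ hull B}
      let f : V → Finset X := fun v => if hv : ∃ B ∈ P, v ∈ hull B then hv.choose else ∅
      have hf : ∀ B ∈ P, ∀ v ∈ hull B, f v = B := by
        intro B hB v hv
        have hex : ∃ B ∈ P, v ∈ hull B := ⟨B, hB, hv⟩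
        have : f v = hex.choose := dif_pos hex
        rw [this]
        exact hd _ hex.choose_spec.1 _ hB v hex.choose_spec.2 hv
      have hlab : ∀ B, ∀ x ∈ B, T.label x ∈ hull B := fun B x hx => ⟨x, hx, x, hx, sg_left _ _⟩
      obtain ⟨h', h1, h2, h3⟩ := extend_conn hG _ U f (P : Set (Finset X)) rfl
        (by
          obtain ⟨x⟩ := ‹Nonempty X›
          obtain ⟨B, hB, hx⟩ := h.cov x (Finset.mem_univ _)
          exact ⟨T.label x, B, hB, hlab B x hx⟩)
        (by
          rintro v ⟨B, hB, hv⟩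
          rw [hf B hB v hv]; exact hB)
        (by
          intro B hB
          have : {v | v ∈ U ∧ f v = B} = hull B := by
            ext v
            constructor
            · rintro ⟨⟨B', hB', hv⟩, e⟩
              rw [hf B' hB' v hv] at e
              rw [← e]; exact hv
            · intro hv
              exact ⟨⟨B, hB, hv⟩, hf B hB v hv⟩
          rw [this]; exact hconn B hB)
      refine ⟨h', h2, ?_, h3⟩
      intro x B hB hx
      rw [h1 _ ⟨B, hB, hlab B x hx⟩, hf B hB _ (hlab B x hx)]
  · rintro ⟨⟨-, -, hcov⟩, ⟨h, h1, h2, h3⟩, hsz⟩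
    refine ⟨hsz, fun _ _ => Finset.subset_univ _, fun a _ => hcov a, ?_⟩
    have sub : ∀ B ∈ P, ∀ a ∈ B, ∀ b ∈ B, ∀ w ∈ sg T.graph (T.label a) (T.label b), h w = B := by
      intro B hB a ha b hb w hw
      obtain ⟨p⟩ := (h3 B hB).preconnected ⟨T.label a, h2 a B hB ha⟩ ⟨T.label b, h2 b B hB hb⟩
      have h5 := hw (p.map (Embedding.induce _).toHom)
      have h6 := Walk.support_map (Embedding.induce {v | h v = B} : _ ↪g T.graph).toHom p
      have h7 : w ∈ List.map (Embedding.induce {v | h v = B} : _ ↪g T.graph).toHom p.support :=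
        h6 ▸ h5
      obtain ⟨u, -, rfl⟩ := List.mem_map.1 h7
      exact u.2
    intro C hC C' hC' hCC a ha b hb c hc d hd
    rw [Set.disjoint_left]
    intro w hw hw'
    exact hCC (by rw [← sub C hC a ha b hb w hw, sub C' hC' c hc d hd w hw'])

lemma gCount_eq [Finite V] [Finite X] (T : UnrootedBinaryTree V X) (h : 2 ≤ Nat.card X) (r : ℕ) :
    gCount T 2 r = cnt (Nat.card X) r := by
  classical
  have := Fintype.ofFinite X
  have : Nonempty X := (Nat.card_pos_iff.1 (by omega)).1
  have key := goodSet_ncard (s := fun a b => sg T.graph (T.label a) (T.label b))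
    (fun a => ⟨_, sg_left _ _⟩) (fun a b => sg_symm _ _)
    (fun a b => by
      simp only [sg_self, Set.singleton_subset_iff]
      exact sg_left _ _)
    (tree_cherry T) (Nat.card X) r Finset.univ (by simp)
  rw [← key, gCount, ← Nat.card_coe_set_eq]
  congr 1
  have e : {P : Finset (Finset X) | IsCharacter P ∧ IsConvexChar T P ∧ P.card = r ∧
      ∀ B ∈ P, 2 ≤ B.card} = goodSet (fun a b => sg T.graph (T.label a) (T.label b)) Finset.univ r := by
    ext P
    simp only [goodSet, Set.mem_ofPred_eq, good_iff]
    tauto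
  rw [← e]
  rfl

end Final

/-- `g₂(T, r)` and `g₂(T)` are independent of tree topology. -/
theorem g2_topology_independent {V V' X X' : Type} [Finite V] [Finite V'] [Finite X] [Finite X']
    (T : UnrootedBinaryTree V X) (T' : UnrootedBinaryTree V' X') (n : ℕ)
    (h : Nat.card X = n) (h' : Nat.card X' = n) (hn : 2 ≤ n) :
    (∀ r : ℕ, 1 ≤ r → gCount T 2 r = gCount T' 2 r) ∧ gTotal T 2 = gTotal T' 2 := by
  have key : ∀ r, gCount T 2 r = gCount T' 2 r := by
    intro r
    rw [gCount_eq T (by omega), gCount_eq T' (by omega), h, h']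
  refine ⟨fun r _ => key r, ?_⟩
  unfold gTotal
  rw [h, h']
  exact Finset.sum_congr rfl (fun r _ => key r)
end

section
/- Let n ≥ 2 be even, let T be an unrooted binary phylogenetic tree on n taxa, and let T' be an unrooted binary phylogenetic tree on n/2 taxa. Then g_2(T) = g_1(T'); that is, the number of convex characters on T in which each state appears on at least two taxa equals the total number of convex characters on T'. -/
open SimpleGraph

section Comb
open Classical Finset

structure SplitSys {X : Type} (𝒮 : Set (Set X)) : Prop where
  compl : ∀ s ∈ 𝒮, sᶜ ∈ 𝒮
  compat : ∀ s ∈ 𝒮, ∀ t ∈ 𝒮, ∀ a b c d, a ∈ s → a ∈ t → b ∈ s → b ∉ t → c ∉ s → c ∈ t →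
    d ∉ s → d ∉ t → False
  single : ∀ x, {x} ∈ 𝒮
  cherry : ∀ S : Finset X, 2 ≤ S.card → ∃ x ∈ S, ∃ y ∈ S, x ≠ y ∧ ∃ t ∈ 𝒮, ∀ z ∈ S,
    (z ∈ t ↔ z = x ∨ z = y)

def SepBy {X : Type} (𝒮 : Set (Set X)) (A B : Finset X) : Prop :=
  ∃ s ∈ 𝒮, (∀ a ∈ A, a ∈ s) ∧ ∀ b ∈ B, b ∉ s

structure IsCP {X : Type} (𝒮 : Set (Set X)) (k : ℕ) (S : Finset X) (P : Finset (Finset X)) :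
    Prop where
  sub : ∀ B ∈ P, B ⊆ S
  ne : ∀ B ∈ P, B.Nonempty
  cov : ∀ x ∈ S, ∃ B ∈ P, x ∈ B
  sep : ∀ B ∈ P, ∀ B' ∈ P, B ≠ B' → SepBy 𝒮 B B'
  big : ∀ B ∈ P, k ≤ B.card

noncomputable def CPs {X : Type} (𝒮 : Set (Set X)) (k : ℕ) (S : Finset X) :
    Finset (Finset (Finset X)) := S.powerset.powerset.filter (IsCP 𝒮 k S)

theorem mem_CPs {X : Type} {𝒮 : Set (Set X)} {k : ℕ} {S : Finset X} {P : Finset (Finset X)} :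
    P ∈ CPs 𝒮 k S ↔ IsCP 𝒮 k S P := by
  simp only [CPs, mem_filter, mem_powerset, and_iff_right_iff_imp]
  intro h B hB
  exact mem_powerset.2 (h.sub B hB)

variable {X : Type} {𝒮 : Set (Set X)}

theorem SepBy.symm (h𝒮 : SplitSys 𝒮) {A B : Finset X} (h : SepBy 𝒮 A B) : SepBy 𝒮 B A := by
  obtain ⟨s, hs, h1, h2⟩ := h
  exact ⟨sᶜ, h𝒮.compl s hs, h2, fun a ha h => h (h1 a ha)⟩

theorem IsCP.uniq {k : ℕ} {S : Finset X} {P : Finset (Finset X)} (h : IsCP 𝒮 k S P)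
    {A B : Finset X} (hA : A ∈ P) (hB : B ∈ P) {x : X} (hxA : x ∈ A) (hxB : x ∈ B) : A = B := by
  by_contra hne
  obtain ⟨s, _, h1, h2⟩ := h.sep A hA B hB hne
  exact h2 x hxB (h1 x hxA)

/-- Removing a block. -/
theorem block_bij (h𝒮 : SplitSys 𝒮) {k : ℕ} {S B : Finset X} (hBS : B ⊆ S) (hB : B.Nonempty)
    (hk : k ≤ B.card) (hs : ∀ C, C ⊆ S \ B → SepBy 𝒮 B C) (p : Finset (Finset X) → Prop)
    (hp : ∀ P, p (insert B P) ↔ p P) :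
    ((CPs 𝒮 k S).filter (fun P => B ∈ P ∧ p P)).card = ((CPs 𝒮 k (S \ B)).filter p).card := by
  have hnot : ∀ P, IsCP 𝒮 k (S \ B) P → B ∉ P := by
    intro P hP h
    obtain ⟨x, hx⟩ := hB
    have := hP.sub B h hx
    simp [hx] at this
  refine Finset.card_bij' (fun P _ => P.erase B) (fun P _ => insert B P) ?_ ?_ ?_ ?_
  · intro P hP
    simp only [mem_filter, mem_CPs] at hP ⊢
    obtain ⟨hP, hBP, hpP⟩ := hP
    refine ⟨⟨?_, ?_, ?_, ?_, ?_⟩, ?_⟩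
    · intro C hC x hx
      have hC' := mem_erase.1 hC
      refine mem_sdiff.2 ⟨hP.sub C hC'.2 hx, fun hxB => hC'.1 (hP.uniq hC'.2 hBP hx hxB)⟩
    · exact fun C hC => hP.ne C (mem_erase.1 hC).2
    · intro x hx
      obtain ⟨C, hC, hxC⟩ := hP.cov x (mem_sdiff.1 hx).1
      refine ⟨C, mem_erase.2 ⟨?_, hC⟩, hxC⟩
      rintro rfl
      exact (mem_sdiff.1 hx).2 hxC
    · exact fun C hC D hD => hP.sep C (mem_erase.1 hC).2 D (mem_erase.1 hD).2
    · exact fun C hC => hP.big C (mem_erase.1 hC).2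
    · rw [← hp, insert_erase hBP]; exact hpP
  · intro P hP
    simp only [mem_filter, mem_CPs] at hP ⊢
    obtain ⟨hP, hpP⟩ := hP
    refine ⟨⟨?_, ?_, ?_, ?_, ?_⟩, mem_insert_self _ _, (hp P).2 hpP⟩
    · intro C hC
      rcases mem_insert.1 hC with rfl | hC
      · exact hBS
      · exact (hP.sub C hC).trans sdiff_subset
    · intro C hC
      rcases mem_insert.1 hC with rfl | hC
      · exact hB
      · exact hP.ne C hC
    · intro x hx
      by_cases hxB : x ∈ B
      · exact ⟨B, mem_insert_self _ _, hxB⟩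
      · obtain ⟨C, hC, hxC⟩ := hP.cov x (mem_sdiff.2 ⟨hx, hxB⟩)
        exact ⟨C, mem_insert_of_mem hC, hxC⟩
    · intro C hC D hD hne
      rcases mem_insert.1 hC with rfl | hCP
      · rcases mem_insert.1 hD with rfl | hD
        · exact absurd rfl hne
        · exact hs D (hP.sub D hD)
      · rcases mem_insert.1 hD with rfl | hD
        · exact (hs C (hP.sub C hCP)).symm h𝒮
        · exact hP.sep C hCP D hD hne
    · intro C hC
      rcases mem_insert.1 hC with rfl | hC
      · exact hk
      · exact hP.big C hC
  · intro P hP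
    exact insert_erase (mem_filter.1 hP).2.1
  · intro P hP
    exact erase_insert (hnot P (mem_CPs.1 (mem_filter.1 hP).1))

/-- Merging a cherry. -/
theorem merge_bij (h𝒮 : SplitSys 𝒮) {k : ℕ} {S : Finset X} {x y : X} (hx : x ∈ S) (hy : y ∈ S)
    (hxy : x ≠ y) {t : Set X} (ht : t ∈ 𝒮) (htS : ∀ z ∈ S, (z ∈ t ↔ z = x ∨ z = y)) :
    ((CPs 𝒮 k S).filter (fun P => (∃ B ∈ P, x ∈ B ∧ y ∈ B) ∧ ∀ B ∈ P, k ≤ (B.erase y).card)).card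
      = (CPs 𝒮 k (S.erase y)).card := by
  have key : ∀ A ⊆ S.erase y, ∀ B ⊆ S.erase y, x ∈ A → B.Nonempty → SepBy 𝒮 A B →
      SepBy 𝒮 (insert y A) B := by
    intro A hA B hB hxA hBne hsep
    obtain ⟨s, hs, h1, h2⟩ := hsep
    by_cases hys : y ∈ s
    · exact ⟨s, hs, by simpa [hys] using h1, h2⟩
    have hBt : ∀ b ∈ B, b ∉ t := by
      intro b hb hbt
      rcases (htS b (mem_erase.1 (hB hb)).2).1 hbt with rfl | rfl
      · exact h2 b hb (h1 b hxA)
      · exact (mem_erase.1 (hB hb)).1 rfl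
    refine ⟨t, ht, ?_, hBt⟩
    intro a ha
    rcases mem_insert.1 ha with rfl | ha
    · exact (htS a hy).2 (Or.inr rfl)
    by_contra hat
    obtain ⟨b, hb⟩ := hBne
    exact h𝒮.compat s hs t ht x a y b (h1 x hxA) ((htS x hx).2 (Or.inl rfl)) (h1 a ha) hat hys
      ((htS y hy).2 (Or.inr rfl)) (h2 b hb) (hBt b hb)
  have memxy : ∀ P, IsCP 𝒮 k S P → (∃ B ∈ P, x ∈ B ∧ y ∈ B) → ∀ B ∈ P, (x ∈ B ↔ y ∈ B) := by
    rintro P hP ⟨C, hC, hxC, hyC⟩ B hB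
    constructor
    · intro h; rw [hP.uniq hB hC h hxC]; exact hyC
    · intro h; rw [hP.uniq hB hC h hyC]; exact hxC
  refine Finset.card_bij' (fun P _ => P.image (fun B => B.erase y))
    (fun P _ => P.image (fun B => if x ∈ B then insert y B else B)) ?_ ?_ ?_ ?_
  · intro P hP
    simp only [mem_filter, mem_CPs] at hP ⊢
    obtain ⟨hP, hxyP, hbig⟩ := hP
    have hm := memxy P hP hxyP
    refine ⟨?_, ?_, ?_, ?_, ?_⟩
    · intro C hC
      obtain ⟨B, hB, rfl⟩ := mem_image.1 hC
      exact erase_subset_erase _ (hP.sub B hB)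
    · intro C hC
      obtain ⟨B, hB, rfl⟩ := mem_image.1 hC
      obtain ⟨z, hz⟩ := hP.ne B hB
      by_cases hzy : z = y
      · subst hzy
        exact ⟨x, mem_erase.2 ⟨hxy, (hm B hB).2 hz⟩⟩
      · exact ⟨z, mem_erase.2 ⟨hzy, hz⟩⟩
    · intro z hz
      obtain ⟨B, hB, hzB⟩ := hP.cov z (mem_erase.1 hz).2
      exact ⟨_, mem_image_of_mem _ hB, mem_erase.2 ⟨(mem_erase.1 hz).1, hzB⟩⟩
    · intro C hC D hD hne
      obtain ⟨B, hB, rfl⟩ := mem_image.1 hC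
      obtain ⟨B', hB', rfl⟩ := mem_image.1 hD
      obtain ⟨s, hs, h1, h2⟩ := hP.sep B hB B' hB' (by rintro rfl; exact hne rfl)
      exact ⟨s, hs, fun a ha => h1 a (mem_erase.1 ha).2, fun a ha => h2 a (mem_erase.1 ha).2⟩
    · intro C hC
      obtain ⟨B, hB, rfl⟩ := mem_image.1 hC
      exact hbig B hB
  · intro P hP
    simp only [mem_filter, mem_CPs] at hP ⊢
    have hyB : ∀ B ∈ P, y ∉ B := fun B hB h => (mem_erase.1 (hP.sub B hB h)).1 rfl
    refine ⟨⟨?_, ?_, ?_, ?_, ?_⟩, ?_, ?_⟩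
    · intro C hC
      obtain ⟨B, hB, rfl⟩ := mem_image.1 hC
      have := (hP.sub B hB).trans (erase_subset _ _)
      split_ifs
      · exact insert_subset hy this
      · exact this
    · intro C hC
      obtain ⟨B, hB, rfl⟩ := mem_image.1 hC
      split_ifs
      · exact insert_nonempty _ _
      · exact hP.ne B hB
    · intro z hz
      by_cases hzy : z = y
      · subst hzy
        obtain ⟨B, hB, hxB⟩ := hP.cov x (mem_erase.2 ⟨hxy, hx⟩)
        refine ⟨_, mem_image_of_mem _ hB, ?_⟩
        simp [hxB]
      · obtain ⟨B, hB, hzB⟩ := hP.cov z (mem_erase.2 ⟨hzy, hz⟩)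
        refine ⟨_, mem_image_of_mem _ hB, ?_⟩
        split_ifs
        · exact mem_insert_of_mem hzB
        · exact hzB
    · intro C hC D hD hne
      obtain ⟨B, hB, rfl⟩ := mem_image.1 hC
      obtain ⟨B', hB', rfl⟩ := mem_image.1 hD
      have hne' : B ≠ B' := by rintro rfl; exact hne rfl
      have hsep := hP.sep B hB B' hB' hne'
      by_cases h1 : x ∈ B
      · have h2 : x ∉ B' := fun h2 => hne' (hP.uniq hB hB' h1 h2)
        simp only [h1, h2, if_true, if_false]
        exact key B (hP.sub B hB) B' (hP.sub B' hB') h1 (hP.ne B' hB') hsep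
      · by_cases h2 : x ∈ B'
        · simp only [h1, h2, if_true, if_false]
          exact (key B' (hP.sub B' hB') B (hP.sub B hB) h2 (hP.ne B hB) (hsep.symm h𝒮)).symm h𝒮
        · simp only [h1, h2, if_false]
          exact hsep
    · intro C hC
      obtain ⟨B, hB, rfl⟩ := mem_image.1 hC
      have := hP.big B hB
      split_ifs
      · exact this.trans (card_le_card (subset_insert _ _))
      · exact this
    · obtain ⟨B, hB, hxB⟩ := hP.cov x (mem_erase.2 ⟨hxy, hx⟩)
      refine ⟨_, mem_image_of_mem _ hB, ?_⟩
      simp [hxB]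
    · intro C hC
      obtain ⟨B, hB, rfl⟩ := mem_image.1 hC
      have := hP.big B hB
      split_ifs
      · rw [erase_insert (hyB B hB)]; exact this
      · rw [erase_eq_of_notMem (hyB B hB)]; exact this
  · intro P hP
    simp only [mem_filter, mem_CPs] at hP
    obtain ⟨hP, hxyP, hbig⟩ := hP
    have hm := memxy P hP hxyP
    simp only [image_image]
    refine (image_congr (g := id) ?_).trans image_id
    intro B hB
    have := hm B hB
    by_cases hxB : x ∈ B
    · simp [hxB, hxy, insert_erase (this.1 hxB)]
    · have hyB : y ∉ B := fun h => hxB (this.2 h)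
      simp [hxB, erase_eq_of_notMem hyB]
  · intro P hP
    simp only [mem_CPs] at hP
    have hyB : ∀ B ∈ P, y ∉ B := fun B hB h => (mem_erase.1 (hP.sub B hB h)).1 rfl
    simp only [image_image]
    refine (image_congr (g := id) ?_).trans image_id
    intro B hB
    have := hyB B hB
    by_cases hxB : x ∈ B
    · simp [hxB, erase_insert this]
    · simp [hxB, erase_eq_of_notMem this]

theorem cherry_dichotomy (h𝒮 : SplitSys 𝒮) {k : ℕ} {S : Finset X} {x y : X} (hx : x ∈ S)
    (hy : y ∈ S) {t : Set X} (ht : t ∈ 𝒮)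
    (htS : ∀ z ∈ S, (z ∈ t ↔ z = x ∨ z = y)) {P : Finset (Finset X)} (hP : IsCP 𝒮 k S P)
    (hns : ¬ ∃ B ∈ P, x ∈ B ∧ y ∈ B) : {x} ∈ P ∨ {y} ∈ P := by
  obtain ⟨A, hA, hxA⟩ := hP.cov x hx
  obtain ⟨B, hB, hyB⟩ := hP.cov y hy
  have hyA : y ∉ A := fun h => hns ⟨A, hA, hxA, h⟩
  have hxB : x ∉ B := fun h => hns ⟨B, hB, h, hyB⟩
  obtain ⟨s, hs, h1, h2⟩ := hP.sep A hA B hB (by rintro rfl; exact hyA hyB)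
  by_contra hcon
  push Not at hcon
  have ha : ∃ a ∈ A, a ≠ x := by
    by_contra h
    push Not at h
    exact hcon.1 (by rwa [← (eq_singleton_iff_unique_mem.2 ⟨hxA, h⟩)])
  have hb : ∃ a ∈ B, a ≠ y := by
    by_contra h
    push Not at h
    exact hcon.2 (by rwa [← (eq_singleton_iff_unique_mem.2 ⟨hyB, h⟩)])
  obtain ⟨a, ha, hax⟩ := ha
  obtain ⟨b, hb, hby⟩ := hb
  refine h𝒮.compat s hs t ht x a y b (h1 x hxA) ((htS x hx).2 (Or.inl rfl)) (h1 a ha) ?_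
    (h2 y hyB) ((htS y hy).2 (Or.inr rfl)) (h2 b hb) ?_
  · intro h
    rcases (htS a (hP.sub A hA ha)).1 h with rfl | rfl
    · exact hax rfl
    · exact hyA ha
  · intro h
    rcases (htS b (hP.sub B hB hb)).1 h with rfl | rfl
    · exact hxB hb
    · exact hby rfl

theorem single_sep (h𝒮 : SplitSys 𝒮) {S : Finset X} (x : X) :
    ∀ C, C ⊆ S \ {x} → SepBy 𝒮 {x} C := by
  intro C hC
  refine ⟨{x}, h𝒮.single x, by simp, ?_⟩
  intro b hb
  have := hC hb
  simp at this
  simpa using this.2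

theorem rec_one (h𝒮 : SplitSys 𝒮) {S : Finset X} {x y : X} (hx : x ∈ S) (hy : y ∈ S)
    (hxy : x ≠ y) {t : Set X} (ht : t ∈ 𝒮) (htS : ∀ z ∈ S, (z ∈ t ↔ z = x ∨ z = y)) :
    (CPs 𝒮 1 S).card + (CPs 𝒮 1 ((S.erase y).erase x)).card =
      (CPs 𝒮 1 (S.erase y)).card + (CPs 𝒮 1 (S.erase x)).card + (CPs 𝒮 1 (S.erase y)).card := by
  have e1 : ((CPs 𝒮 1 S).filter
        (fun P => (∃ B ∈ P, x ∈ B ∧ y ∈ B) ∧ ∀ B ∈ P, 1 ≤ (B.erase y).card)).card =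
      (CPs 𝒮 1 (S.erase y)).card := by
    convert merge_bij (k := 1) h𝒮 hx hy hxy ht htS
  have e2 := block_bij (k := 1) h𝒮 (singleton_subset_iff.2 hx) (singleton_nonempty x) (by simp)
    (single_sep h𝒮 x) (fun _ => True) (by simp)
  have e3 := block_bij (k := 1) h𝒮 (singleton_subset_iff.2 hy) (singleton_nonempty y) (by simp)
    (single_sep h𝒮 y) (fun P => {x} ∉ P) (by simp [hxy])
  have e4 := block_bij (k := 1) (S := S.erase y) h𝒮
    (singleton_subset_iff.2 (mem_erase.2 ⟨hxy, hx⟩)) (singleton_nonempty x) (by simp)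
    (single_sep h𝒮 x) (fun _ => True) (by simp)
  simp only [sdiff_singleton_eq_erase, and_true, filter_true] at e2 e3 e4
  have e5 := card_filter_add_card_filter_not (s := CPs 𝒮 1 (S.erase y)) (fun P => {x} ∈ P)
  have e6 := card_filter_add_card_filter_not (s := CPs 𝒮 1 S) (fun P => {x} ∈ P)
  have e7 := card_filter_add_card_filter_not (s := (CPs 𝒮 1 S).filter (fun P => {x} ∉ P))
    (fun P => {y} ∈ P)
  have e8 : ((CPs 𝒮 1 S).filter (fun P => {x} ∉ P)).filter (fun P => {y} ∈ P) =
      (CPs 𝒮 1 S).filter (fun P => {y} ∈ P ∧ {x} ∉ P) := by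
    ext P; simp only [mem_filter]; tauto
  have e9 : ((CPs 𝒮 1 S).filter (fun P => {x} ∉ P)).filter (fun P => {y} ∉ P) =
      (CPs 𝒮 1 S).filter
        (fun P => (∃ B ∈ P, x ∈ B ∧ y ∈ B) ∧ ∀ B ∈ P, 1 ≤ (B.erase y).card) := by
    ext P
    simp only [mem_filter, mem_CPs, and_assoc]
    refine and_congr_right fun hP => ?_
    constructor
    · rintro ⟨h1, h2⟩
      have hs : ∃ B ∈ P, x ∈ B ∧ y ∈ B := by
        by_contra hns
        rcases cherry_dichotomy h𝒮 hx hy ht htS hP hns with h | h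
        · exact h1 h
        · exact h2 h
      refine ⟨hs, ?_⟩
      intro B hB
      rw [Nat.one_le_iff_ne_zero, Finset.card_ne_zero]
      obtain ⟨z, hz⟩ := hP.ne B hB
      by_cases hzy : z = y
      · subst hzy
        obtain ⟨C, hC, hxC, hyC⟩ := hs
        exact ⟨x, mem_erase.2 ⟨hxy, by rwa [hP.uniq hB hC hz hyC]⟩⟩
      · exact ⟨z, mem_erase.2 ⟨hzy, hz⟩⟩
    · rintro ⟨⟨C, hC, hxC, hyC⟩, -⟩
      constructor
      · intro h
        have := hP.uniq hC h hxC (mem_singleton_self x)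
        rw [this] at hyC
        exact hxy (mem_singleton.1 hyC).symm
      · intro h
        have := hP.uniq hC h hyC (mem_singleton_self y)
        rw [this] at hxC
        exact hxy (mem_singleton.1 hxC)
  rw [e8, e9] at e7
  have e3' : ((CPs 𝒮 1 S).filter (fun P => {y} ∈ P ∧ {x} ∉ P)).card =
      ((CPs 𝒮 1 (S.erase y)).filter (fun P => {x} ∉ P)).card := by
    convert e3
  omega

theorem rec_two (h𝒮 : SplitSys 𝒮) {S : Finset X} {x y : X} (hx : x ∈ S) (hy : y ∈ S)
    (hxy : x ≠ y) {t : Set X} (ht : t ∈ 𝒮) (htS : ∀ z ∈ S, (z ∈ t ↔ z = x ∨ z = y)) :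
    (CPs 𝒮 2 S).card = (CPs 𝒮 2 (S.erase y)).card + (CPs 𝒮 2 ((S.erase y).erase x)).card := by
  have e1 : ((CPs 𝒮 2 S).filter
        (fun P => (∃ B ∈ P, x ∈ B ∧ y ∈ B) ∧ ∀ B ∈ P, 2 ≤ (B.erase y).card)).card =
      (CPs 𝒮 2 (S.erase y)).card := by
    convert merge_bij (k := 2) h𝒮 hx hy hxy ht htS
  have e2 := block_bij (k := 2) (B := {x, y}) h𝒮 (S := S)
    (by intro z hz; simp at hz; rcases hz with rfl | rfl <;> assumption)
    ⟨x, by simp⟩ (by simp [card_pair hxy]) (by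
      intro C hC
      refine ⟨t, ht, ?_, ?_⟩
      · intro a ha
        simp at ha
        rcases ha with rfl | rfl
        · exact (htS _ hx).2 (Or.inl rfl)
        · exact (htS _ hy).2 (Or.inr rfl)
      · intro b hb h
        have := hC hb
        rw [mem_sdiff] at this
        have h' := (htS b this.1).1 h
        exact this.2 (by simpa using h')) (fun _ => True) (by simp)
  have e3 : S \ {x, y} = (S.erase y).erase x := by
    ext z; simp only [mem_sdiff, mem_erase, mem_insert, mem_singleton]; tauto
  rw [e3] at e2
  simp only [and_true, filter_true] at e2
  have e6 := card_filter_add_card_filter_not (s := CPs 𝒮 2 S) (fun P => {x, y} ∈ P)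
  have e9 : (CPs 𝒮 2 S).filter (fun P => {x, y} ∉ P) =
      (CPs 𝒮 2 S).filter
        (fun P => (∃ B ∈ P, x ∈ B ∧ y ∈ B) ∧ ∀ B ∈ P, 2 ≤ (B.erase y).card) := by
    ext P
    simp only [mem_filter, mem_CPs]
    refine and_congr_right fun hP => ?_
    constructor
    · intro h
      have hs : ∃ B ∈ P, x ∈ B ∧ y ∈ B := by
        by_contra hns
        rcases cherry_dichotomy h𝒮 hx hy ht htS hP hns with h | h
        · simpa using hP.big _ h
        · simpa using hP.big _ h
      refine ⟨hs, ?_⟩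
      intro B hB
      by_cases hyB : y ∈ B
      · obtain ⟨C, hC, hxC, hyC⟩ := hs
        obtain rfl := hP.uniq hB hC hyB hyC
        by_contra hlt
        have hle : (B.erase y).card ≤ 1 := by omega
        have hxm : x ∈ B.erase y := mem_erase.2 ⟨hxy, hxC⟩
        have : B.erase y = {x} := by
          refine eq_singleton_iff_unique_mem.2 ⟨hxm, fun z hz => ?_⟩
          exact card_le_one.1 hle z hz x hxm
        apply h
        have h2 := insert_erase hyB
        rw [this] at h2
        rw [pair_comm, h2]
        exact hB
      · rw [erase_eq_of_notMem hyB]; exact hP.big B hB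
    · rintro ⟨-, h⟩ hm
      have := h _ hm
      have h2 : ({x, y} : Finset X).erase y = {x} := by
        ext z; simp only [mem_erase, mem_insert, mem_singleton]
        constructor
        · tauto
        · rintro rfl; exact ⟨hxy, Or.inl rfl⟩
      rw [h2] at this
      simp at this
  rw [e9] at e6
  omega

theorem CPs_empty (k : ℕ) : (CPs 𝒮 k (∅ : Finset X)).card = 1 := by
  rw [card_eq_one]
  refine ⟨∅, ?_⟩
  ext P
  rw [mem_CPs, mem_singleton]
  constructor
  · intro h
    rw [eq_empty_iff_forall_notMem]
    intro B hB
    have h1 := h.sub B hB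
    have h2 := h.ne B hB
    rw [subset_empty.1 h1] at h2
    simp at h2
  · rintro rfl
    constructor <;> simp

theorem CPs_one_single (h𝒮 : SplitSys 𝒮) (x : X) : (CPs 𝒮 1 {x}).card = 1 := by
  have e2 := block_bij (k := 1) h𝒮 (Subset.refl {x}) (singleton_nonempty x) (by simp)
    (single_sep h𝒮 x) (fun _ => True) (by simp)
  rw [sdiff_self] at e2
  simp only [and_true, filter_true, bot_eq_empty, CPs_empty] at e2
  rw [filter_true_of_mem] at e2
  · exact e2
  intro P hP
  rw [mem_CPs] at hP
  obtain ⟨B, hB, hx⟩ := hP.cov x (mem_singleton_self x)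
  have := (hP.ne B hB).subset_singleton_iff.1 (hP.sub B hB)
  rwa [← this]

theorem CPs_two_single (x : X) : (CPs 𝒮 2 {x}).card = 0 := by
  rw [card_eq_zero, eq_empty_iff_forall_notMem]
  intro P hP
  rw [mem_CPs] at hP
  obtain ⟨B, hB, hx⟩ := hP.cov x (mem_singleton_self x)
  have h1 := card_le_card (hP.sub B hB)
  have h2 := hP.big B hB
  simp at h1
  omega

theorem count (h𝒮 : SplitSys 𝒮) (m : ℕ) : ∀ S : Finset X, S.card = m + 1 →
    (CPs 𝒮 1 S).card = Nat.fib (2 * m + 1) ∧ (CPs 𝒮 2 S).card = Nat.fib m := by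
  induction m using Nat.strong_induction_on with
  | _ m ih =>
    intro S hS
    rcases m with _ | m
    · obtain ⟨x, rfl⟩ := card_eq_one.1 hS
      exact ⟨by rw [CPs_one_single h𝒮]; rfl, by rw [CPs_two_single]; rfl⟩
    obtain ⟨x, hx, y, hy, hxy, t, ht, htS⟩ := h𝒮.cherry S (by omega)
    have r1 := rec_one h𝒮 hx hy hxy ht htS
    have r2 := rec_two h𝒮 hx hy hxy ht htS
    have c1 : (S.erase x).card = m + 1 := by rw [card_erase_of_mem hx]; omega
    have c2 : (S.erase y).card = m + 1 := by rw [card_erase_of_mem hy]; omega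
    have c3 : ((S.erase y).erase x).card = m := by
      rw [card_erase_of_mem (mem_erase.2 ⟨hxy, hx⟩)]; omega
    obtain ⟨i1, -⟩ := ih m (by omega) _ c1
    obtain ⟨i2, i3⟩ := ih m (by omega) _ c2
    rw [i1, i2] at r1
    rw [i3] at r2
    rcases m with _ | m
    · rw [card_eq_zero.1 c3, CPs_empty] at r1 r2
      constructor
      · simp [Nat.fib] at r1 ⊢; omega
      · simpa using r2
    · obtain ⟨i4, i5⟩ := ih m (by omega) _ c3
      rw [i4] at r1
      rw [i5] at r2
      constructor
      · have f1 : Nat.fib (2 * (m + 1 + 1) + 1) = _ := Nat.fib_add_two (n := 2 * m + 3)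
        have f2 : Nat.fib (2 * m + 3 + 1) = _ := Nat.fib_add_two (n := 2 * m + 2)
        have f3 : Nat.fib (2 * (m + 1) + 1) = _ := Nat.fib_add_two (n := 2 * m + 1)
        have g1 : 2 * m + 2 + 1 = 2 * (m + 1) + 1 := by ring
        have g2 : 2 * m + 1 + 1 = 2 * m + 2 := by ring
        have g3 : 2 * m + 3 = 2 * (m + 1) + 1 := by ring
        rw [g1] at f2; rw [g2] at f3; rw [g3] at f1
        omega
      · rw [r2, Nat.fib_add_two, add_comm]

end Comb

section Tree
open Classical

variable {V : Type} {G : SimpleGraph V}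

/-- The component of `u` after deleting the edge `uv`. -/
def side (G : SimpleGraph V) (u v : V) : Set V :=
  {w | (G.deleteEdges {s(u, v)}).Reachable u w}

theorem side_self (u v : V) : u ∈ side G u v := Reachable.refl _

theorem side_not (hG : G.IsTree) {u v : V} (h : G.Adj u v) : v ∉ side G u v :=
  isBridge_iff.1 (isAcyclic_iff_forall_adj_isBridge.1 hG.isAcyclic h)

theorem side_step {u v a b : V} (ha : a ∈ side G u v) (hab : G.Adj a b)
    (hne : s(a, b) ≠ s(u, v)) : b ∈ side G u v := by
  refine Reachable.trans ha (Adj.reachable ?_)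
  rw [deleteEdges_adj]
  exact ⟨hab, by simpa using hne⟩

theorem side_cross (hG : G.IsTree) {u v a b : V} (h : G.Adj u v) (ha : a ∈ side G u v)
    (hab : G.Adj a b) (hb : b ∉ side G u v) : a = u ∧ b = v := by
  by_cases hne : s(a, b) = s(u, v)
  · rcases Sym2.eq_iff.1 hne with h' | ⟨rfl, rfl⟩
    · exact h'
    · exact absurd ha (side_not hG h)
  · exact absurd (side_step ha hab hne) hb

theorem side_or (hG : G.IsTree) (u v w : V) : w ∈ side G u v ∨ w ∈ side G v u := by
  obtain ⟨p⟩ := hG.connected.preconnected w u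
  induction p with
  | nil => exact Or.inl (side_self _ _)
  | cons h p ih =>
    rename_i a b u
    by_cases hne : s(b, a) = s(u, v)
    · rcases Sym2.eq_iff.1 hne with ⟨rfl, rfl⟩ | ⟨rfl, rfl⟩
      · exact Or.inr (side_self _ _)
      · exact Or.inl (side_self _ _)
    · rcases ih with ih | ih
      · exact Or.inl (side_step ih h.symm hne)
      · exact Or.inr (side_step ih h.symm (by rwa [Sym2.eq_swap (a := v)]))

theorem side_compl (hG : G.IsTree) {u v : V} (h : G.Adj u v) (w : V) :
    w ∈ side G v u ↔ w ∉ side G u v := by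
  constructor
  · intro h1 h2
    refine side_not hG h (Reachable.trans h2 (Reachable.symm ?_))
    have h1 : (G.deleteEdges {s(v, u)}).Reachable v w := h1
    rwa [Sym2.eq_swap] at h1
  · intro h1
    exact (side_or hG u v w).resolve_left h1

theorem side_induct {u v : V} (Q : V → Prop) (h0 : Q u)
    (hs : ∀ a b, a ∈ side G u v → b ∈ side G u v → G.Adj a b → Q a → Q b) :
    ∀ w ∈ side G u v, Q w := by
  intro w hw
  have hw' := (reachable_iff_reflTransGen u w).1 hw
  induction hw' with
  | refl => exact h0
  | tail hab hbc ih =>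
    rename_i b c
    have hb : b ∈ side G u v := (reachable_iff_reflTransGen u b).2 hab
    exact hs b c hb hw (deleteEdges_le _ hbc) (ih hb)

theorem side_K (hG : G.IsTree) {u v u' v' : V} (h' : G.Adj u' v')
    (hn : ¬ (u' ∈ side G u v ∧ v' ∈ side G u v)) :
    ∀ w ∈ side G u v, (w ∈ side G u' v' ↔ u ∈ side G u' v') := by
  apply side_induct
  · rfl
  · intro a b ha hb hab hQ
    rw [← hQ]
    constructor
    · intro hbE
      by_contra haE
      obtain ⟨rfl, rfl⟩ := side_cross hG h' hbE hab.symm haE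
      exact hn ⟨hb, ha⟩
    · intro haE
      by_contra hbE
      obtain ⟨rfl, rfl⟩ := side_cross hG h' haE hab hbE
      exact hn ⟨ha, hb⟩

theorem side_compat (hG : G.IsTree) {u v u' v' : V} (h : G.Adj u v) (h' : G.Adj u' v')
    {a b c d : V} (ha : a ∈ side G u v) (ha' : a ∈ side G u' v') (hb : b ∈ side G u v)
    (hb' : b ∉ side G u' v') (hc : c ∉ side G u v) (hc' : c ∈ side G u' v')
    (hd : d ∉ side G u v) (hd' : d ∉ side G u' v') : False := by
  by_cases hn : u' ∈ side G u v ∧ v' ∈ side G u v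
  · have hn' : ¬ (u' ∈ side G v u ∧ v' ∈ side G v u) := fun h2 =>
      (side_compl hG h u').1 h2.1 hn.1
    have k := side_K hG h' hn'
    have := k c ((side_compl hG h c).2 hc)
    have := k d ((side_compl hG h d).2 hd)
    tauto
  · have k := side_K hG h' hn
    have := k a ha
    have := k b hb
    tauto

theorem walk_cross_s2 (hG : G.IsTree) {u v c b : V} (h : G.Adj u v) (p : G.Walk c b)
    (hc : c ∉ side G u v) (hb : b ∈ side G u v) : u ∈ p.support := by
  induction p with
  | nil => exact absurd hb hc
  | cons hab p ih =>
    rename_i x y z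
    by_cases hy : y ∈ side G u v
    · obtain ⟨rfl, rfl⟩ := side_cross hG h hy hab.symm hc
      simp
    · simp [ih hy hb]

theorem path_side (hG : G.IsTree) {u v a b : V} (h : G.Adj u v) (p : G.Walk a b) (hp : p.IsPath)
    (ha : a ∈ side G u v) (hb : b ∈ side G u v) : ∀ w ∈ p.support, w ∈ side G u v := by
  induction p with
  | nil => intro w hw; simp at hw; rwa [hw]
  | cons hab p ih =>
    rename_i x y z
    rw [Walk.cons_isPath_iff] at hp
    by_cases hy : y ∈ side G u v
    · intro w hw
      rw [Walk.support_cons, List.mem_cons] at hw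
      rcases hw with rfl | hw
      · exact ha
      · exact ih hp.1 hy hb w hw
    · obtain ⟨rfl, rfl⟩ := side_cross hG h ha hab hy
      exact absurd (walk_cross_s2 hG h p hy hb) hp.2

/-- A connected set that avoids one end of the edge stays on one side. -/
theorem conn_side (hG : G.IsTree) {u v : V} (h : G.Adj u v) {C : Set V}
    (hC : (G.induce C).Preconnected) (hn : ¬ (u ∈ C ∧ v ∈ C)) {c : V} (hc : c ∈ C)
    (hcs : c ∈ side G u v) : ∀ w ∈ C, w ∈ side G u v := by
  intro w hw
  have hr := (reachable_iff_reflTransGen _ _).1 (hC ⟨c, hc⟩ ⟨w, hw⟩)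
  have : ∀ z : C, Relation.ReflTransGen (G.induce C).Adj ⟨c, hc⟩ z → z.1 ∈ side G u v := by
    intro z hz
    induction hz with
    | refl => exact hcs
    | tail _ hbc ih =>
      rename_i b d _
      by_contra hd
      have hbd : G.Adj b.1 d.1 := hbc
      obtain ⟨h1, h2⟩ := side_cross hG h ih hbd hd
      exact hn ⟨h1 ▸ b.2, h2 ▸ d.2⟩
  exact this _ hr

theorem path_tail_side {a a' b : V} (hab : G.Adj a a') (p : G.Walk a' b) (ha : a ∉ p.support) :
    b ∈ side G a' a := by
  refine reachable_deleteEdges_iff_exists_walk.2 ⟨p, fun he => ha ?_⟩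
  exact p.snd_mem_support_of_mem_edges he

/-- Two disjoint connected sets are separated by an edge. -/
theorem conn_sep (hG : G.IsTree) {A B : Set V} (hA : (G.induce A).Preconnected)
    (hB : (G.induce B).Preconnected) (hAB : ∀ w, w ∈ A → w ∈ B → False) {a b : V} (ha : a ∈ A)
    (hb : b ∈ B) : ∃ u v, G.Adj u v ∧ (∀ w ∈ A, w ∈ side G u v) ∧ ∀ w ∈ B, w ∉ side G u v := by
  obtain ⟨p, hp, -⟩ := hG.existsUnique_path a b
  induction p with
  | nil => exact (hAB _ ha hb).elim
  | cons hab p ih =>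
    rename_i x y z
    rw [Walk.cons_isPath_iff] at hp
    by_cases hy : y ∈ A
    · exact ih hy hb hp.1
    · refine ⟨x, y, hab, ?_, ?_⟩
      · exact conn_side hG hab hA (fun h => hy h.2) ha (side_self _ _)
      · intro w hw
        rw [← side_compl hG hab]
        exact conn_side hG hab.symm hB (fun h => hAB _ ha h.2) hb (path_tail_side hab p hp.2) w hw

/-- The intersection of all sides containing a set is connected. -/
def hull (G : SimpleGraph V) (B : Set V) : Set V :=
  {w | ∀ u v, G.Adj u v → (∀ x ∈ B, x ∈ side G u v) → w ∈ side G u v}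

theorem subset_hull {B : Set V} {x : V} (hx : x ∈ B) : x ∈ hull G B :=
  fun _ _ _ h => h x hx

theorem hull_conn (hG : G.IsTree) (B : Set V) : (G.induce (hull G B)).Preconnected := by
  rintro ⟨a, ha⟩ ⟨b, hb⟩
  obtain ⟨p, hp, -⟩ := hG.existsUnique_path a b
  have hsub : {w | w ∈ p.support} ⊆ hull G B := by
    intro w hw u v huv h
    exact path_side hG huv p hp (ha u v huv h) (hb u v huv h) w hw
  have := p.connected_induce_support.preconnected ⟨a, p.start_mem_support⟩
    ⟨b, p.end_mem_support⟩
  exact this.map (induceHomOfLE _ hsub).toHom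

theorem extend_fun [Finite V] (hG : G.Connected) {ι : Type} (n : ℕ) : ∀ f : V → Option ι,
    {v | f v = none}.ncard = n → (∃ v, f v ≠ none) →
    (∀ i, (G.induce {v | f v = some i}).Preconnected) →
    ∃ h : V → ι, (∀ v i, f v = some i → h v = i) ∧ (∀ v, ∃ v', f v' = some (h v)) ∧
      ∀ i, (G.induce {v | h v = i}).Preconnected := by
  induction n with
  | zero =>
    intro f hf _ hc
    rw [Set.ncard_eq_zero] at hf
    have hsome : ∀ v, ∃ i, f v = some i := by
      intro v
      rcases hv : f v with _ | i
      · have : v ∈ {v | f v = none} := hv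
        rw [hf] at this
        exact this.elim
      · exact ⟨i, rfl⟩
    choose h hh using hsome
    refine ⟨h, ?_, fun v => ⟨v, hh v⟩, ?_⟩
    · intro v i hv
      rw [hh v] at hv
      exact Option.some.inj hv
    · intro i
      have : {v | h v = i} = {v | f v = some i} := by
        ext v; simp [hh v]
      rw [this]
      exact hc i
  | succ n ih =>
    intro f hf hex hc
    have hw : ∃ w w' i, G.Adj w w' ∧ f w = none ∧ f w' = some i := by
      have hne : {v | f v = none}.Nonempty := by
        rw [← Set.ncard_pos]; omega
      obtain ⟨a, ha⟩ := hne
      obtain ⟨b, hb⟩ := hex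
      obtain ⟨p⟩ := hG.preconnected a b
      induction p with
      | nil => exact absurd ha hb
      | cons hab p ih2 =>
        rename_i x y z
        rcases hy : f y with _ | i
        · exact ih2 hy hb
        · exact ⟨x, y, i, hab, ha, hy⟩
    obtain ⟨w, w', i, hww, hw, hw'⟩ := hw
    obtain ⟨h, h1, h2, h3⟩ := ih (Function.update f w (some i)) (by
        have : {v | Function.update f w (some i) v = none} = {v | f v = none} \ {w} := by
          ext v
          by_cases hv : v = w
          · subst hv; simp
          · simp [hv]
        rw [this, Set.ncard_sdiff_singleton_of_mem (show w ∈ {v | f v = none} from hw)]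
        omega) ⟨w, by simp⟩ (by
        intro j
        by_cases hj : j = i
        · subst hj
          have : {v | Function.update f w (some j) v = some j} = {v | f v = some j} ∪ {w} := by
            ext v
            by_cases hv : v = w
            · subst hv; simp
            · simp [hv]
          rw [this]
          refine (connected_induce_union (hc j) ?_ hw' (Set.mem_singleton w) hww.symm).preconnected
          rintro ⟨a, ha⟩ ⟨b, hb⟩
          obtain rfl := Set.mem_singleton_iff.1 ha
          obtain rfl := Set.mem_singleton_iff.1 hb
          exact Reachable.refl _
        · have : {v | Function.update f w (some i) v = some j} = {v | f v = some j} := by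
            ext v
            by_cases hv : v = w
            · subst hv; simp [hw, Ne.symm hj]
            · simp [hv]
          rw [this]
          exact hc j)
    refine ⟨h, ?_, ?_, h3⟩
    · intro v j hv
      refine h1 v j ?_
      have : v ≠ w := by rintro rfl; rw [hw] at hv; cases hv
      simp [this, hv]
    · intro v
      obtain ⟨v', hv'⟩ := h2 v
      by_cases hv : v' = w
      · subst hv
        simp at hv'
        exact ⟨w', by rw [hw', hv']⟩
      · exact ⟨v', by simpa [hv] using hv'⟩

/-- The splits of the taxa induced by the edges, together with the two trivial ones. -/
def splits {X : Type} (T : UnrootedBinaryTree V X) : Set (Set X) :=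
  {s | s = Set.univ ∨ s = ∅ ∨ ∃ u v, T.graph.Adj u v ∧ s = T.label ⁻¹' side T.graph u v}

variable {X : Type} (T : UnrootedBinaryTree V X)

theorem leaf_side {u v : V} (hu : vdeg T.graph u = 1) (h : T.graph.Adj u v) :
    side T.graph u v = {u} := by
  obtain ⟨c, hc⟩ := Set.ncard_eq_one.1 hu
  have hv : v ∈ T.graph.neighborSet u := h
  rw [hc] at hv
  obtain rfl := Set.mem_singleton_iff.1 hv
  apply Set.Subset.antisymm
  · refine side_induct (fun w => w = u) rfl ?_
    rintro a b ha hb hab rfl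
    have hb' : b ∈ T.graph.neighborSet a := hab
    rw [hc] at hb'
    obtain rfl := Set.mem_singleton_iff.1 hb'
    exact absurd hb (side_not T.isTree h)
  · rintro _ rfl
    exact side_self _ _

theorem exists_nbr (u : V) : ∃ v, T.graph.Adj u v := by
  have : (T.graph.neighborSet u).ncard ≠ 0 := by
    have := T.degOneOrThree u
    unfold vdeg at this
    omega
  exact Set.nonempty_of_ncard_ne_zero this

theorem tree_cherry_s2 [Finite V] (S : Finset X) (hS : 3 ≤ S.card) :
    ∃ u v, T.graph.Adj u v ∧ (S.filter (fun x => T.label x ∈ side T.graph u v)).card = 2 := by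
  set N : V × V → ℕ := fun q => (S.filter (fun x => T.label x ∈ side T.graph q.1 q.2)).card with hN
  let M : Set (V × V) := {q | T.graph.Adj q.1 q.2 ∧ 2 ≤ N q}
  have hMne : M.Nonempty := by
    have hSne : S.Nonempty := by rw [← Finset.card_pos]; omega
    obtain ⟨z, hz⟩ := hSne
    obtain ⟨v, hv⟩ := exists_nbr T (T.label z)
    refine ⟨(v, T.label z), hv.symm, ?_⟩
    have : S.erase z ⊆ S.filter (fun x => T.label x ∈ side T.graph v (T.label z)) := by
      intro x hx
      rw [Finset.mem_erase] at hx
      rw [Finset.mem_filter]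
      refine ⟨hx.2, ?_⟩
      rw [side_compl T.isTree hv, leaf_side T (T.label_leaf z) hv]
      exact fun h => hx.1 (T.label_inj h)
    have := Finset.card_le_card this
    rw [Finset.card_erase_of_mem hz] at this
    simp only [hN]
    omega
  obtain ⟨⟨u, v⟩, ⟨huv, h2⟩, hmin⟩ := Set.exists_min_image M
    (fun q => (side T.graph q.1 q.2).ncard) (Set.toFinite M) hMne
  dsimp only at huv hmin
  refine ⟨u, v, huv, le_antisymm ?_ h2⟩
  have hu : vdeg T.graph u = 3 := by
    rcases T.degOneOrThree u with h1 | h3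
    · exfalso
      simp only [hN, leaf_side T h1 huv] at h2
      have : (S.filter (fun x => T.label x ∈ ({u} : Set V))).card ≤ 1 := by
        rw [Finset.card_le_one]
        intro a ha b hb
        simp only [Finset.mem_filter, Set.mem_singleton_iff] at ha hb
        exact T.label_inj (ha.2.trans hb.2.symm)
      omega
    · exact h3
  have hnb : (T.graph.neighborSet u \ {v}).ncard = 2 := by
    have hv : v ∈ T.graph.neighborSet u := huv
    rw [Set.ncard_sdiff_singleton_of_mem hv]
    unfold vdeg at hu
    omega
  obtain ⟨c1, c2, -, hc⟩ := Set.ncard_eq_two.1 hnb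
  have small : ∀ c ∈ T.graph.neighborSet u \ {v}, N (c, u) ≤ 1 := by
    intro c hcm
    have huc : T.graph.Adj u c := hcm.1
    have hcv : c ≠ v := hcm.2
    by_contra hgt
    have hle := hmin (c, u) ⟨huc.symm, by omega⟩
    dsimp only at hle
    have hss : side T.graph c u ⊂ side T.graph u v := by
      refine ⟨?_, fun h => side_not T.isTree huc.symm (h (side_self u v))⟩
      refine side_induct (fun w => w ∈ side T.graph u v) ?_ ?_
      · by_contra hcD
        exact hcv (side_cross T.isTree huv (side_self u v) huc hcD).2
      · intro a b ha hb hab haD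
        by_contra hbD
        obtain ⟨rfl, -⟩ := side_cross T.isTree huv haD hab hbD
        exact side_not T.isTree huc.symm ha
    have := Set.ncard_lt_ncard hss
    omega
  have hsub : S.filter (fun x => T.label x ∈ side T.graph u v) ⊆
      S.filter (fun x => T.label x ∈ side T.graph c1 u) ∪
      S.filter (fun x => T.label x ∈ side T.graph c2 u) := by
    intro x hx
    rw [Finset.mem_filter] at hx
    obtain ⟨p, hp, -⟩ := T.isTree.existsUnique_path u (T.label x)
    cases hpe : p with
    | nil =>
      have := T.label_leaf x
      omega
    | cons hab q =>
      rename_i c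
      rw [hpe, Walk.cons_isPath_iff] at hp
      have hcs := path_tail_side hab q hp.2
      have hcv : c ≠ v := by
        rintro rfl
        exact (side_compl T.isTree huv _).1 hcs hx.2
      have hcm : c ∈ T.graph.neighborSet u \ {v} := ⟨hab, hcv⟩
      rw [hc] at hcm
      simp only [Finset.mem_union, Finset.mem_filter]
      rcases hcm with rfl | h
      · exact Or.inl ⟨hx.1, hcs⟩
      · obtain rfl := Set.mem_singleton_iff.1 h
        exact Or.inr ⟨hx.1, hcs⟩
  have h1 := small c1 (by rw [hc]; simp)
  have h2' := small c2 (by rw [hc]; simp)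
  simp only [hN] at h1 h2'
  have := (Finset.card_le_card hsub).trans (Finset.card_union_le _ _)
  omega

theorem splits_sys [Finite V] : SplitSys (splits T) where
  compl := by
    rintro s (rfl | rfl | ⟨u, v, h, rfl⟩)
    · exact Or.inr (Or.inl (by simp))
    · exact Or.inl (by simp)
    · refine Or.inr (Or.inr ⟨v, u, h.symm, ?_⟩)
      ext x
      exact (side_compl T.isTree h _).symm
  compat := by
    rintro s (rfl | rfl | ⟨u, v, h, rfl⟩) t (rfl | rfl | ⟨u', v', h', rfl⟩) a b c d
      h1 h2 h3 h4 h5 h6 h7 h8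
    · exact h4 trivial
    · exact h2
    · exact h5 trivial
    · exact h4 trivial
    · exact h1
    · exact h1
    · exact h4 trivial
    · exact h2
    · exact side_compat T.isTree h h' h1 h2 h3 h4 h5 h6 h7 h8
  single := by
    intro x
    obtain ⟨v, hv⟩ := exists_nbr T (T.label x)
    refine Or.inr (Or.inr ⟨T.label x, v, hv, ?_⟩)
    rw [leaf_side T (T.label_leaf x) hv]
    ext y
    simp [T.label_inj.eq_iff]
  cherry := by
    intro S hS
    by_cases h2 : S.card = 2
    · obtain ⟨x, y, hxy, rfl⟩ := Finset.card_eq_two.1 h2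
      refine ⟨x, by simp, y, by simp, hxy, Set.univ, Or.inl rfl, ?_⟩
      intro z hz
      simpa using hz
    · obtain ⟨u, v, huv, hc⟩ := tree_cherry_s2 T S (by omega)
      obtain ⟨x, y, hxy, he⟩ := Finset.card_eq_two.1 hc
      have hm : ∀ z, (z ∈ S ∧ T.label z ∈ side T.graph u v) ↔ z = x ∨ z = y := by
        intro z
        rw [← Finset.mem_filter (p := fun x => T.label x ∈ side T.graph u v), he]
        simp
      refine ⟨x, ((hm x).2 (Or.inl rfl)).1, y, ((hm y).2 (Or.inr rfl)).1, hxy, _,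
        Or.inr (Or.inr ⟨u, v, huv, rfl⟩), ?_⟩
      intro z hz
      rw [← hm z]
      simp [hz]

theorem convex_sep {P : Finset (Finset X)} (hP : IsCharacter P) (hc : IsConvexChar T P) :
    ∀ A ∈ P, ∀ B ∈ P, A ≠ B → SepBy (splits T) A B := by
  intro A hA B hB hne
  obtain ⟨h, h1, h2, h3⟩ := hc
  obtain ⟨a, ha⟩ := hP.1 A hA
  obtain ⟨b, hb⟩ := hP.1 B hB
  obtain ⟨u, v, huv, k1, k2⟩ := conn_sep T.isTree (h3 A hA).preconnected (h3 B hB).preconnected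
    (fun w hwA hwB => hne (hwA.symm.trans hwB)) (h2 a A hA ha) (h2 b B hB hb)
  exact ⟨_, Or.inr (Or.inr ⟨u, v, huv, rfl⟩), fun x hx => k1 _ (h2 x A hA hx),
    fun x hx => k2 _ (h2 x B hB hx)⟩

theorem sep_convex [Finite V] [Nonempty X] {P : Finset (Finset X)} (hP : IsCharacter P)
    (hs : ∀ A ∈ P, ∀ B ∈ P, A ≠ B → SepBy (splits T) A B) : IsConvexChar T P := by
  let H : Finset X → Set V := fun B => hull T.graph (T.label '' (B : Set X))
  have hdis : ∀ A ∈ P, ∀ B ∈ P, ∀ w, w ∈ H A → w ∈ H B → A = B := by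
    intro A hA B hB w hwA hwB
    by_contra hne
    obtain ⟨s, hsm, h1, h2⟩ := hs A hA B hB hne
    obtain ⟨a, ha⟩ := hP.1 A hA
    obtain ⟨b, hb⟩ := hP.1 B hB
    rcases hsm with rfl | rfl | ⟨u, v, huv, rfl⟩
    · exact h2 b hb trivial
    · exact h1 a ha
    · have k1 := hwA u v huv (by rintro _ ⟨x, hx, rfl⟩; exact h1 x hx)
      have k2 := hwB v u huv.symm (by
        rintro _ ⟨x, hx, rfl⟩
        rw [side_compl T.isTree huv]
        exact h2 x hx)
      exact (side_compl T.isTree huv w).1 k2 k1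
  let f : V → Option (Finset X) := fun v =>
    if h : ∃ B ∈ P, v ∈ H B then some h.choose else none
  have hf : ∀ v B, f v = some B ↔ B ∈ P ∧ v ∈ H B := by
    intro v B
    by_cases h : ∃ B ∈ P, v ∈ H B
    · have hsp := h.choose_spec
      have : f v = some h.choose := by simp only [f, dif_pos h]
      rw [this]
      constructor
      · intro he
        rw [← Option.some.inj he]
        exact hsp
      · intro hB
        rw [hdis _ hsp.1 B hB.1 v hsp.2 hB.2]
    · have : f v = none := by simp only [f, dif_neg h]
      rw [this]
      constructor
      · intro he; cases he
      · intro hB; exact absurd ⟨B, hB⟩ h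
  have hlab : ∀ x B, B ∈ P → x ∈ B → f (T.label x) = some B := by
    intro x B hB hx
    exact (hf _ _).2 ⟨hB, subset_hull ⟨x, hx, rfl⟩⟩
  obtain ⟨x0⟩ := ‹Nonempty X›
  obtain ⟨B0, hB0, hx0⟩ := hP.2.2 x0
  obtain ⟨h, h1, h2, h3⟩ := extend_fun T.isTree.connected _ f rfl
    ⟨T.label x0, by rw [hlab x0 B0 hB0 hx0]; simp⟩ (by
      intro B
      by_cases hB : B ∈ P
      · have : {v | f v = some B} = H B := by
          ext v; simp [hf, hB]
        rw [this]
        exact hull_conn T.isTree _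
      · rintro ⟨a, ha⟩
        exact absurd ((hf a B).1 ha).1 hB)
  refine ⟨h, ?_, ?_, ?_⟩
  · intro v
    obtain ⟨v', hv'⟩ := h2 v
    exact ((hf _ _).1 hv').1
  · intro x B hB hx
    exact h1 _ _ (hlab x B hB hx)
  · intro B hB
    obtain ⟨b, hb⟩ := hP.1 B hB
    have : Nonempty {v | h v = B} := ⟨⟨T.label b, h1 _ _ (hlab b B hB hb)⟩⟩
    exact ⟨h3 B⟩

theorem isCP_iff [Finite V] [Fintype X] [Nonempty X] (k : ℕ) (P : Finset (Finset X)) :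
    IsCP (splits T) k Finset.univ P ↔
      IsCharacter P ∧ IsConvexChar T P ∧ ∀ B ∈ P, k ≤ B.card := by
  constructor
  · intro h
    have hP : IsCharacter P := by
      refine ⟨h.ne, ?_, fun x => h.cov x (Finset.mem_univ x)⟩
      intro B hB B' hB' hne
      rw [Finset.disjoint_left]
      exact fun x hx hx' => hne (h.uniq hB hB' hx hx')
    exact ⟨hP, sep_convex T hP h.sep, h.big⟩
  · rintro ⟨hP, hc, hb⟩
    exact ⟨fun B _ => Finset.subset_univ B, hP.1, fun x _ => hP.2.2 x, convex_sep T hP hc, hb⟩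

theorem gTotal_eq [Finite V] [Fintype X] [Nonempty X] (k : ℕ) :
    gTotal T k = (CPs (splits T) k Finset.univ).card := by
  unfold gTotal
  rw [Finset.card_eq_sum_card_fiberwise (f := Finset.card)
    (t := Finset.Icc 1 (Nat.card X))]
  · refine Finset.sum_congr rfl fun r _ => ?_
    unfold gCount
    rw [← Nat.card_eq_finsetCard]
    refine Nat.card_congr (Equiv.subtypeEquivRight ?_)
    intro P
    rw [Finset.mem_filter, mem_CPs, isCP_iff]
    tauto
  · intro P hP
    have hP := mem_CPs.1 (Finset.mem_coe.1 hP)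
    rw [Finset.mem_coe, Finset.mem_Icc]
    constructor
    · obtain ⟨B, hB, -⟩ := hP.cov (Classical.arbitrary X) (Finset.mem_univ _)
      exact Finset.card_pos.2 ⟨B, hB⟩
    · rw [Nat.card_eq_fintype_card, ← Finset.card_univ]
      refine Finset.card_le_card_of_injOn
        (fun B => if h : B.Nonempty then h.choose else Classical.arbitrary X)
        (fun _ _ => Finset.mem_coe.2 (Finset.mem_univ _)) ?_
      intro A hA B hB hAB
      have hA' := hP.ne A hA
      have hB' := hP.ne B hB
      simp only [dif_pos hA', dif_pos hB'] at hAB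
      exact hP.uniq hA hB hA'.choose_spec (hAB ▸ hB'.choose_spec)

end Tree

/-- for even `n`, `g₂` of a tree on `n` taxa equals `g₁` of a tree on `n/2` taxa. -/
theorem g2_eq_g1_half {V V' X X' : Type} [Finite V] [Finite V'] [Finite X] [Finite X']
    (T : UnrootedBinaryTree V X) (T' : UnrootedBinaryTree V' X') (n : ℕ)
    (hn2 : 2 ≤ n) (hev : Even n) (h : Nat.card X = n) (h' : Nat.card X' = n / 2) :
    gTotal T 2 = gTotal T' 1 := by
  have := Fintype.ofFinite X
  have := Fintype.ofFinite X'
  obtain ⟨m, rfl⟩ := hev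
  obtain ⟨m, rfl⟩ : ∃ j, m = j + 1 := ⟨m - 1, by omega⟩
  have : Nonempty X := (Nat.card_pos_iff.1 (by omega)).1
  have : Nonempty X' := (Nat.card_pos_iff.1 (by omega)).1
  rw [gTotal_eq, gTotal_eq]
  rw [Nat.card_eq_fintype_card, ← Finset.card_univ] at h h'
  rw [(count (splits_sys T) (2 * m + 1) Finset.univ (by omega)).2,
    (count (splits_sys T') m Finset.univ (by omega)).1]
end
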